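/- For every integer n ≥ 1 there exists a Lipschitz map f : S^n → ℍⁿ (S^n the unit sphere in ℝ^{n+1}, f Lipschitz from the Euclidean metric to the Carnot–Carathéodory metric) such that there is no map F : B^{n+1} → ℍⁿ satisfying both: (i) F ∈ W^{1,n+1}(B^{n+1}, ℍⁿ), and (ii) F|_{S^n} = f in the sense of traces, meaning that whenever F_k : B^{n+1} → ℝ^{2n+1} is a sequence of maps that are C^1 up to the boundary and F_k → F in the W^{1,n+1}(B^{n+1},ℝ^{2n+1}) norm, the classical restrictions F_k|_{S^n} converge to f in L^{n+1}(S^n,ℝ^{2n+1}). -/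

import Mathlib

open MeasureTheory Metric Set
noncomputable section

/-- `Euc d` is `ℝ^d` with the Euclidean metric. -/
abbrev Euc (d : ℕ) := EuclideanSpace ℝ (Fin d)

/-- The index of the coordinate `x_j` in `ℍⁿ = ℝ^{2n+1}`. -/
def xIdx (n : ℕ) (j : Fin n) : Fin (2*n+1) := ⟨2*(j:ℕ), by have := j.isLt; omega⟩

/-- The index of the coordinate `y_j` in `ℍⁿ = ℝ^{2n+1}`. -/
def yIdx (n : ℕ) (j : Fin n) : Fin (2*n+1) := ⟨2*(j:ℕ)+1, by have := j.isLt; omega⟩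

/-- The index of the coordinate `t` in `ℍⁿ = ℝ^{2n+1}`. -/
def tIdx (n : ℕ) : Fin (2*n+1) := ⟨2*n, by omega⟩

/-- `γ` is an absolutely continuous curve on `[a,b]` with a.e. derivative `g`
(each component is the integral of the corresponding component of `g`), which is
horizontal: the derivative of the `t`-component satisfies the contact condition. -/
def IsHorizontalWith (n : ℕ) (a b : ℝ) (γ g : ℝ → Euc (2*n+1)) : Prop :=
  (∀ i, IntervalIntegrable (fun s => g s i) volume a b) ∧
  (∀ i, ∀ x ∈ Set.Icc a b, γ x i = γ a i + ∫ s in a..x, g s i) ∧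
  (∀ᵐ s ∂(volume.restrict (Set.Icc a b)),
    g s (tIdx n) = 2 * ∑ j : Fin n,
      (γ s (yIdx n j) * g s (xIdx n j) - γ s (xIdx n j) * g s (yIdx n j)))

/-- The horizontal length of a horizontal curve with a.e. derivative `g`:
the Euclidean length of the projection to `ℝ^{2n}`. -/
def horizLength (n : ℕ) (a b : ℝ) (g : ℝ → Euc (2*n+1)) : ℝ :=
  ∫ s in a..b, Real.sqrt (∑ j : Fin n, ((g s (xIdx n j))^2 + (g s (yIdx n j))^2))

/-- The Carnot–Carathéodory distance on `ℍⁿ`. -/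
def ccDist (n : ℕ) (p q : Euc (2*n+1)) : ℝ :=
  sInf { ℓ : ℝ | ∃ a b γ g, a ≤ b ∧ IsHorizontalWith n a b γ g ∧
    γ a = p ∧ γ b = q ∧ ℓ = horizLength n a b g }

/-- `f` is `L`-Lipschitz on `Z` as a map into `ℍⁿ` with the Carnot–Carathéodory metric. -/
def LipschitzOnCC (m n : ℕ) (L : ℝ) (Z : Set (Euc m)) (f : Euc m → Euc (2*n+1)) : Prop :=
  ∀ x ∈ Z, ∀ y ∈ Z, ccDist n (f x) (f y) ≤ L * dist x y

/-- `v` represents the distributional partial derivative `∂u/∂x_k` on `Ω`. -/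
def IsWeakPartialDeriv (m : ℕ) (Ω : Set (Euc m)) (u : Euc m → ℝ) (k : Fin m)
    (v : Euc m → ℝ) : Prop :=
  ∀ φ : Euc m → ℝ, ContDiff ℝ (⊤ : ℕ∞) φ → HasCompactSupport φ → tsupport φ ⊆ Ω →
    ∫ x in Ω, u x * fderiv ℝ φ x (EuclideanSpace.single k 1) = - ∫ x in Ω, v x * φ x

/-- `u ∈ L^p(Ω)`. -/
def MemLpOn (m : ℕ) (p : ℝ) (Ω : Set (Euc m)) (u : Euc m → ℝ) : Prop :=
  MemLp u (ENNReal.ofReal p) (volume.restrict Ω)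

/-- `u ∈ W^{1,p}(Ω)` with weak partial derivatives `v k = ∂u/∂x_k ∈ L^p(Ω)`. -/
def MemW1pWith (m : ℕ) (p : ℝ) (Ω : Set (Euc m)) (u : Euc m → ℝ)
    (v : Fin m → Euc m → ℝ) : Prop :=
  MemLpOn m p Ω u ∧ ∀ k, MemLpOn m p Ω (v k) ∧ IsWeakPartialDeriv m Ω u k (v k)

/-- The weak contact equation holds a.e. on `Ω` for `F` with weak partial
derivatives `v i k = ∂F_i/∂x_k`. -/
def ContactAEOn (m n : ℕ) (Ω : Set (Euc m)) (F : Euc m → Euc (2*n+1))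
    (v : Fin (2*n+1) → Fin m → Euc m → ℝ) : Prop :=
  ∀ᵐ x ∂(volume.restrict Ω), ∀ k : Fin m,
    v (tIdx n) k x = 2 * ∑ j : Fin n,
      (F x (yIdx n j) * v (xIdx n j) k x - F x (xIdx n j) * v (yIdx n j) k x)

/-- `F ∈ W^{1,p}(Ω,ℍⁿ)` with weak partial derivatives `v`:
all components belong to `W^{1,p}(Ω)` and the weak contact equation holds a.e. -/
def MemW1pHeisWith (m n : ℕ) (p : ℝ) (Ω : Set (Euc m)) (F : Euc m → Euc (2*n+1))
    (v : Fin (2*n+1) → Fin m → Euc m → ℝ) : Prop :=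
  (∀ i, MemW1pWith m p Ω (fun x => F x i) (fun k => v i k)) ∧ ContactAEOn m n Ω F v

/-- The open unit disc in `ℝⁿ`, on which the two hemispheres of `Sⁿ` are graphs. -/
def discOf (n : ℕ) : Set (Fin n → ℝ) := {y | ∑ j, y j ^ 2 < 1}

/-- The graph parametrization, in direction `i`, of the hemisphere of sign `s`. -/
def hemi (n : ℕ) (i : Fin (n+1)) (s : ℝ) (y : Fin n → ℝ) : Euc (n+1) :=
  WithLp.toLp 2 (i.insertNth (s * √(1 - ∑ j, y j ^ 2)) y)

lemma measurableSet_discOf (n : ℕ) : MeasurableSet (discOf n) :=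
  (isOpen_lt (by fun_prop) (by fun_prop)).measurableSet

lemma continuous_insertNth_toLp {X : Type*} [TopologicalSpace X] {n : ℕ} (i : Fin (n+1))
    {a : X → ℝ} {y : X → Fin n → ℝ} (ha : Continuous a) (hy : Continuous y) :
    Continuous fun x => (WithLp.toLp 2 (i.insertNth (a x) (y x) : Fin (n+1) → ℝ) : Euc (n+1)) :=
  (PiLp.continuous_toLp 2 _).comp (ha.finInsertNth i hy)

lemma continuous_hemi (n : ℕ) (i : Fin (n+1)) (s : ℝ) : Continuous (hemi n i s) :=
  continuous_insertNth_toLp i (by fun_prop) continuous_id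

lemma norm_sq_insertNth {n : ℕ} (i : Fin (n+1)) (a : ℝ) (y : Fin n → ℝ) :
    ‖(WithLp.toLp 2 (i.insertNth a y : Fin (n+1) → ℝ) : Euc (n+1))‖ ^ 2
      = a ^ 2 + ∑ j, y j ^ 2 := by
  rw [EuclideanSpace.norm_sq_eq, Fin.sum_univ_succAbove _ i]
  simp

lemma hemi_mem_sphere {n : ℕ} (i : Fin (n+1)) {s : ℝ} (hs : s ^ 2 = 1) {y : Fin n → ℝ}
    (hy : y ∈ discOf n) : hemi n i s y ∈ sphere (0 : Euc (n+1)) 1 := by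
  have h0 : ∑ j, y j ^ 2 < 1 := hy
  have := norm_sq_insertNth i (s * √(1 - ∑ j, y j ^ 2)) y
  rw [mul_pow, hs, Real.sq_sqrt (by linarith)] at this
  rw [mem_sphere_zero_iff_norm]
  have h1 : ‖hemi n i s y‖ ^ 2 = 1 := by rw [hemi, this]; ring
  exact (pow_eq_one_iff_of_nonneg (norm_nonneg _) two_ne_zero).1 h1

/-- Projection along a coordinate does not increase measure, so the flat measure on a hemisphere
is dominated by the Hausdorff measure. -/
lemma map_hemi_le (n : ℕ) (i : Fin (n+1)) {s : ℝ} (hs : s ^ 2 = 1) :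
    (volume.restrict (discOf n)).map (hemi n i s)
      ≤ (μH[(n : ℝ)]).restrict (sphere (0 : Euc (n+1)) 1) := by
  refine Measure.le_iff.2 fun E hE => ?_
  rw [Measure.map_apply (continuous_hemi n i s).measurable hE,
    Measure.restrict_apply ((continuous_hemi n i s).measurable hE), Measure.restrict_apply hE]
  let P : Euc (n+1) → (Fin n → ℝ) := fun x j => x (i.succAbove j)
  have hP : LipschitzWith 1 P := by
    refine LipschitzWith.of_dist_le_mul fun x y => ?_
    rw [NNReal.coe_one, one_mul]
    refine (dist_pi_le_iff dist_nonneg).2 fun j => ?_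
    simp only [P, Real.dist_eq]
    rw [dist_eq_norm]
    simpa using PiLp.norm_apply_le (x - y) (i.succAbove j)
  have hsub : hemi n i s ⁻¹' E ∩ discOf n ⊆ P '' (E ∩ sphere (0 : Euc (n+1)) 1) := by
    rintro y ⟨hy1, hy2⟩
    refine ⟨hemi n i s y, ⟨hy1, hemi_mem_sphere i hs hy2⟩, ?_⟩
    ext j
    simp [P, hemi]
  have hv : (volume : Measure (Fin n → ℝ)) = μH[(n : ℝ)] := by
    rw [← hausdorffMeasure_pi_real, Fintype.card_fin]
  calc volume (hemi n i s ⁻¹' E ∩ discOf n)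
      ≤ volume (P '' (E ∩ sphere (0 : Euc (n+1)) 1)) := measure_mono hsub
    _ ≤ _ := by
      rw [hv]
      simpa using hP.hausdorffMeasure_image_le (d := (n : ℝ)) (by positivity)
        (E ∩ sphere (0 : Euc (n+1)) 1)

lemma discOf_subset_closedBall (n : ℕ) : discOf n ⊆ closedBall (0 : Fin n → ℝ) 1 := by
  intro y hy
  rw [mem_closedBall, dist_zero_right]
  refine (pi_norm_le_iff_of_nonneg zero_le_one).2 fun j => ?_
  have h0 : ∑ j, y j ^ 2 < 1 := hy
  have h1 := Finset.single_le_sum (f := fun j => y j ^ 2) (fun k _ => sq_nonneg _)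
    (Finset.mem_univ j)
  rw [Real.norm_eq_abs]
  exact (sq_le_one_iff_abs_le_one _).1 (by linarith)

lemma volume_discOf_lt_top (n : ℕ) : volume (discOf n) < ⊤ :=
  (measure_mono (discOf_subset_closedBall n)).trans_lt measure_closedBall_lt_top

lemma integral_partialDeriv_slice {n : ℕ} (i : Fin (n+1)) {c : Euc (n+1) → ℝ}
    (hc : ContDiff ℝ 1 c) (y : Fin n → ℝ) :
    ∫ t in Ioo (-√(1 - ∑ j, y j ^ 2)) (√(1 - ∑ j, y j ^ 2)),
        fderiv ℝ c (WithLp.toLp 2 (i.insertNth t y)) (EuclideanSpace.single i 1)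
      = c (hemi n i 1 y) - c (hemi n i (-1) y) := by
  set r := √(1 - ∑ j, y j ^ 2) with hr
  have hr0 : 0 ≤ r := Real.sqrt_nonneg _
  let L : ℝ → Euc (n+1) := fun t => WithLp.toLp 2 (i.insertNth t y)
  have hL : ∀ t, HasDerivAt L (EuclideanSpace.single i 1) t := by
    intro t
    have : L = fun t => L 0 + t • (EuclideanSpace.single i 1 : Euc (n+1)) := by
      funext t
      ext k
      refine Fin.succAboveCases i ?_ (fun j => ?_) k <;> simp [L]
    rw [this]
    simpa using ((hasDerivAt_id t).smul_const (EuclideanSpace.single i 1 : Euc (n+1))).const_add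
      (L 0)
  have hcL : ∀ t, HasDerivAt (fun t => c (L t))
      (fderiv ℝ c (L t) (EuclideanSpace.single i 1)) t := fun t =>
    ((hc.differentiable one_ne_zero (L t)).hasFDerivAt).comp_hasDerivAt t (hL t)
  have hLc : Continuous L := continuous_insertNth_toLp i continuous_id continuous_const
  have hcont : Continuous fun t => fderiv ℝ c (L t) (EuclideanSpace.single i 1) :=
    ((hc.continuous_fderiv one_ne_zero).comp hLc).clm_apply continuous_const
  rw [← integral_Ioc_eq_integral_Ioo, ← intervalIntegral.integral_of_le (by linarith),
    intervalIntegral.integral_eq_sub_of_hasDerivAt (fun t _ => hcL t)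
      (hcont.intervalIntegrable _ _)]
  simp [L, hemi, hr]

/-- The divergence theorem on the unit ball, for a field parallel to the `i`-th axis. -/
lemma integral_ball_partialDeriv {n : ℕ} (i : Fin (n+1)) {c : Euc (n+1) → ℝ}
    (hc : ContDiff ℝ 1 c) :
    ∫ x in ball (0 : Euc (n+1)) 1, fderiv ℝ c x (EuclideanSpace.single i 1)
      = ∫ y in discOf n, (c (hemi n i 1 y) - c (hemi n i (-1) y)) := by
  set d : Euc (n+1) → ℝ := fun x => fderiv ℝ c x (EuclideanSpace.single i 1) with hd
  have hdc : Continuous d := (hc.continuous_fderiv one_ne_zero).clm_apply continuous_const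
  set G : Euc (n+1) → ℝ := (ball (0 : Euc (n+1)) 1).indicator d with hG
  let e : ℝ × (Fin n → ℝ) → Euc (n+1) := fun q => WithLp.toLp 2 (i.insertNth q.1 q.2)
  have he : MeasurePreserving e volume volume :=
    (PiLp.volume_preserving_toLp (Fin (n+1))).comp
      (volume_preserving_piFinSuccAbove (fun _ : Fin (n+1) => ℝ) i).symm
  have hemb : MeasurableEmbedding e :=
    (MeasurableEquiv.toLp 2 (Fin (n+1) → ℝ)).measurableEmbedding.comp
      (MeasurableEquiv.piFinSuccAbove (fun _ : Fin (n+1) => ℝ) i).symm.measurableEmbedding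
  have hGi : Integrable G := by
    rw [hG, integrable_indicator_iff measurableSet_ball]
    exact (hdc.continuousOn.integrableOn_compact (isCompact_closedBall (0 : Euc (n+1)) 1)).mono_set
      ball_subset_closedBall
  rw [← integral_indicator measurableSet_ball, ← hG, ← he.integral_comp hemb]
  have hGe : Integrable (fun q => G (e q)) := (he.integrable_comp_emb hemb).2 hGi
  rw [Measure.volume_eq_prod] at hGe ⊢
  rw [integral_prod_symm _ hGe, ← integral_indicator (measurableSet_discOf n)]
  congr 1
  funext y
  have hmem : ∀ t, e (t, y) ∈ ball (0 : Euc (n+1)) 1 ↔ t ^ 2 + ∑ j, y j ^ 2 < 1 := by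
    intro t
    rw [mem_ball_zero_iff, ← norm_sq_insertNth i t y]
    exact (sq_lt_one_iff₀ (norm_nonneg _)).symm
  by_cases hy : y ∈ discOf n
  · rw [indicator_of_mem hy, ← integral_partialDeriv_slice i hc y,
      ← integral_indicator measurableSet_Ioo]
    congr 1
    funext t
    have h0 : ∑ j, y j ^ 2 < 1 := hy
    have hiff : e (t, y) ∈ ball (0 : Euc (n+1)) 1 ↔
        t ∈ Ioo (-√(1 - ∑ j, y j ^ 2)) (√(1 - ∑ j, y j ^ 2)) := by
      rw [hmem, mem_Ioo, ← abs_lt, Real.lt_sqrt (abs_nonneg t), sq_abs, lt_sub_iff_add_lt]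
    by_cases ht : e (t, y) ∈ ball (0 : Euc (n+1)) 1
    · rw [hG, indicator_of_mem ht, indicator_of_mem (hiff.1 ht)]
    · rw [hG, indicator_of_notMem ht, indicator_of_notMem (fun h => ht (hiff.2 h))]
  · rw [indicator_of_notMem hy]
    refine integral_eq_zero_of_ae (Filter.Eventually.of_forall fun t => ?_)
    have : e (t, y) ∉ ball (0 : Euc (n+1)) 1 := fun h => by
      have := (hmem t).1 h
      exact hy (show ∑ j, y j ^ 2 < 1 by nlinarith [sq_nonneg t])
    simp [hG, indicator_of_notMem this]

open Filter in
/-- Hölder: finite products are continuous with respect to `L^p` convergence of the factors. -/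
lemma tendsto_eLpNorm_finsetProd {α ι : Type*} [MeasurableSpace α] {μ : Measure α}
    {p : ENNReal} (s : Finset ι) (hs : ∑ _i ∈ s, p⁻¹ ≤ 1)
    {F : ℕ → ι → α → ℝ} {f : ι → α → ℝ} (hf : ∀ i ∈ s, MemLp (f i) p μ)
    (hF : ∀ k, ∀ i ∈ s, MemLp (F k i) p μ)
    (h : ∀ i ∈ s, Tendsto (fun k => eLpNorm (fun x => F k i x - f i x) p μ) atTop (nhds 0)) :
    Tendsto (fun k => eLpNorm (fun x => ∏ i ∈ s, F k i x - ∏ i ∈ s, f i x)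
      (∑ _i ∈ s, p⁻¹)⁻¹ μ) atTop (nhds 0) := by
  induction s using Finset.cons_induction with
  | empty =>
    simp only [Finset.prod_empty, sub_self, eLpNorm_zero']
    exact tendsto_const_nhds
  | cons i s hi ih =>
    simp only [Finset.sum_cons, Finset.prod_cons] at hs ⊢
    simp only [Finset.forall_mem_cons] at hf hF h
    have hs' : ∑ _i ∈ s, p⁻¹ ≤ 1 := le_trans le_add_self hs
    have ih := ih hs' hf.2 (fun k => (hF k).2) h.2
    set q := (∑ _i ∈ s, p⁻¹)⁻¹ with hq
    set r := (p⁻¹ + ∑ _i ∈ s, p⁻¹)⁻¹ with hr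
    have hr1 : 1 ≤ r := ENNReal.one_le_inv.2 hs
    have hq1 : 1 ≤ q := ENNReal.one_le_inv.2 hs'
    have : ENNReal.HolderTriple p q r := ⟨by simp [hq, hr]⟩
    have hPf : MemLp (fun x => ∏ i ∈ s, f i x) q μ := MemLp.prod' hf.2
    have hPF : ∀ k, MemLp (fun x => ∏ i ∈ s, F k i x) q μ := fun k => MemLp.prod' (hF k).2
    have key : ∀ k, eLpNorm (fun x => F k i x * ∏ i ∈ s, F k i x - f i x * ∏ i ∈ s, f i x) r μ
        ≤ eLpNorm (fun x => F k i x - f i x) p μ *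
            (eLpNorm (fun x => ∏ i ∈ s, F k i x - ∏ i ∈ s, f i x) q μ
              + eLpNorm (fun x => ∏ i ∈ s, f i x) q μ)
          + eLpNorm (f i) p μ * eLpNorm (fun x => ∏ i ∈ s, F k i x - ∏ i ∈ s, f i x) q μ := by
      intro k
      have e1 : (fun x => F k i x * ∏ i ∈ s, F k i x - f i x * ∏ i ∈ s, f i x)
          = ((fun x => F k i x - f i x) • fun x => ∏ i ∈ s, F k i x)
            + (f i • fun x => ∏ i ∈ s, F k i x - ∏ i ∈ s, f i x) := by
        funext x; simp only [Pi.add_apply, Pi.mul_apply, smul_eq_mul]; ring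
      have m1 : MemLp (fun x => F k i x - f i x) p μ := ((hF k).1).sub hf.1
      have m2 : MemLp (fun x => ∏ i ∈ s, F k i x - ∏ i ∈ s, f i x) q μ := (hPF k).sub hPf
      have e2 : (fun x => ∏ i ∈ s, F k i x) = (fun x => ∏ i ∈ s, F k i x - ∏ i ∈ s, f i x)
          + fun x => ∏ i ∈ s, f i x := by funext x; simp
      rw [e1]
      have m3 : MemLp ((fun x => F k i x - f i x) • fun x => ∏ i ∈ s, F k i x) r μ :=
        (hPF k).smul m1
      have m4 : MemLp (f i • fun x => ∏ i ∈ s, F k i x - ∏ i ∈ s, f i x) r μ := m2.smul hf.1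
      refine (eLpNorm_add_le m3.1 m4.1 hr1).trans (add_le_add
        ((eLpNorm_smul_le_mul_eLpNorm (p := p) (q := q) (r := r) (hPF k).1 m1.1).trans ?_)
        (eLpNorm_smul_le_mul_eLpNorm (p := p) (q := q) (r := r) m2.1 hf.1.1))
      gcongr
      conv_lhs => rw [e2]
      exact eLpNorm_add_le m2.1 hPf.1 hq1
    refine tendsto_of_tendsto_of_tendsto_of_le_of_le tendsto_const_nhds ?_ (fun _ => zero_le)
      key
    have t1 := ENNReal.Tendsto.mul h.1 (Or.inr (by simpa using hPf.2.ne))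
      (ih.add (tendsto_const_nhds (x := eLpNorm (fun x => ∏ i ∈ s, f i x) q μ)))
      (Or.inr ENNReal.zero_ne_top)
    have t2 := ENNReal.Tendsto.const_mul (a := eLpNorm (f i) p μ) ih (Or.inr hf.1.2.ne)
    simpa using t1.add t2

lemma sum_inv_natCast_eq_one (m : ℕ) (hm : m ≠ 0) :
    ∑ _i : Fin m, ((m : ENNReal))⁻¹ = 1 := by
  simp [ENNReal.mul_inv_cancel (Nat.cast_ne_zero.2 hm) (ENNReal.natCast_ne_top m)]

/-- The determinant of an `m × m` matrix with entries in `L^m` is integrable. -/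
lemma integrable_det_of_memLp {α : Type*} [MeasurableSpace α] {μ : Measure α} {m : ℕ}
    (hm : m ≠ 0) {M : α → Matrix (Fin m) (Fin m) ℝ}
    (h : ∀ r i, MemLp (fun x => M x r i) m μ) : Integrable (fun x => (M x).det) μ := by
  simp only [Matrix.det_apply']
  refine integrable_finsetSum _ fun σ _ => Integrable.const_mul ?_ _
  have := MemLp.prod' (s := Finset.univ) (p := fun _ : Fin m => (m : ENNReal))
    (f := fun r x => M x (σ r) r) fun r _ => h (σ r) r
  rw [sum_inv_natCast_eq_one m hm, inv_one] at this
  exact memLp_one_iff_integrable.1 this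

open Filter in
/-- The integral of the determinant is continuous under `L^m` convergence of the entries. -/
lemma tendsto_integral_det {α : Type*} [MeasurableSpace α] {μ : Measure α} {m : ℕ}
    (hm : m ≠ 0) {M : ℕ → α → Matrix (Fin m) (Fin m) ℝ} {N : α → Matrix (Fin m) (Fin m) ℝ}
    (hM : ∀ k r i, MemLp (fun x => M k x r i) m μ) (hN : ∀ r i, MemLp (fun x => N x r i) m μ)
    (h : ∀ r i, Tendsto (fun k => eLpNorm (fun x => M k x r i - N x r i) m μ) atTop (nhds 0)) :
    Tendsto (fun k => ∫ x, (M k x).det ∂μ) atTop (nhds (∫ x, (N x).det ∂μ)) := by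
  have hone := sum_inv_natCast_eq_one m hm
  have hint : ∀ (A : α → Matrix (Fin m) (Fin m) ℝ), (∀ r i, MemLp (fun x => A x r i) m μ) →
      ∀ σ : Equiv.Perm (Fin m), Integrable (fun x => ∏ r, A x (σ r) r) μ := by
    intro A hA σ
    have := MemLp.prod' (s := Finset.univ) (p := fun _ : Fin m => (m : ENNReal))
      (f := fun r x => A x (σ r) r) fun r _ => hA (σ r) r
    rw [hone, inv_one] at this
    exact memLp_one_iff_integrable.1 this
  have hdet : ∀ (A : α → Matrix (Fin m) (Fin m) ℝ), (∀ r i, MemLp (fun x => A x r i) m μ) →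
      ∫ x, (A x).det ∂μ
        = ∑ σ : Equiv.Perm (Fin m), ((σ.sign : ℤ) : ℝ) * ∫ x, ∏ r, A x (σ r) r ∂μ := by
    intro A hA
    simp only [Matrix.det_apply']
    rw [integral_finsetSum _ fun σ _ => (hint A hA σ).const_mul _]
    simp only [integral_const_mul]
  simp only [fun k => hdet (M k) (hM k), hdet N hN]
  refine tendsto_finsetSum _ fun σ _ => Tendsto.const_mul _ ?_
  refine tendsto_integral_of_L1' _ (hint N hN σ).1 (Eventually.of_forall fun k =>
    hint (M k) (hM k) σ) ?_
  have := tendsto_eLpNorm_finsetProd (μ := μ) (p := (m : ENNReal)) Finset.univ hone.le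
    (F := fun k r x => M k x (σ r) r) (f := fun r x => N x (σ r) r) (fun r _ => hN (σ r) r)
    (fun k r _ => hM k (σ r) r) (fun r _ => h (σ r) r)
  rw [hone, inv_one] at this
  exact this

/-- The Jacobian matrix of `a`, whose rows are the gradients of the components. -/
def jac {m : ℕ} (a : Fin m → Euc m → ℝ) (x : Euc m) : Matrix (Fin m) (Fin m) ℝ :=
  Matrix.of fun r i => fderiv ℝ (a r) x (EuclideanSpace.single i 1)

lemma jac_update_updateRow {m : ℕ} (a : Fin m → Euc m → ℝ) (r₀ : Fin m) (b : Euc m → ℝ)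
    (x : Euc m) (v : Fin m → ℝ) :
    (jac (Function.update a r₀ b) x).updateRow r₀ v = (jac a x).updateRow r₀ v := by
  ext r i
  by_cases h : r = r₀
  · subst h; simp
  · simp [Matrix.updateRow_ne h, jac, Function.update_of_ne h]

lemma contDiff_partialDeriv {m : ℕ} {a : Euc m → ℝ} (ha : ContDiff ℝ (⊤ : ℕ∞) a) (v : Euc m) :
    ContDiff ℝ (⊤ : ℕ∞) fun x => fderiv ℝ a x v :=
  (ha.fderiv_right (by simp)).clm_apply contDiff_const

/-- A double sum of a symmetric tensor against the minors in two rows vanishes. -/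
lemma sum_symm_mul_det_updateRow {m : ℕ} (G : Matrix (Fin m) (Fin m) ℝ) {r₀ r : Fin m}
    (hr : r ≠ r₀) (H : Fin m → Fin m → ℝ) (hH : ∀ i l, H i l = H l i) :
    ∑ i, ∑ l, H i l *
      ((G.updateRow r₀ (Pi.single i 1)).updateRow r (Pi.single l 1)).det = 0 := by
  set B : (Fin m → ℝ) → (Fin m → ℝ) → ℝ := fun v w => ((G.updateRow r₀ v).updateRow r w).det
    with hB
  have hBB : ∀ v, B v v = 0 := fun v =>
    Matrix.det_zero_of_row_eq hr (by rw [Matrix.updateRow_self, Matrix.updateRow_ne hr.symm,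
      Matrix.updateRow_self])
  have hadd : ∀ u v w, B w (u + v) = B w u + B w v := fun u v w => Matrix.det_updateRow_add _ _ _ _
  have hadd' : ∀ u v w, B (u + v) w = B u w + B v w := by
    intro u v w
    simp only [hB, Matrix.updateRow_comm _ hr.symm]
    exact Matrix.det_updateRow_add _ _ _ _
  have hanti : ∀ v w, B v w = - B w v := by
    intro v w
    have := hBB (v + w)
    rw [hadd, hadd', hadd', hBB, hBB] at this
    linarith
  have hS : ∑ i, ∑ l, H i l * B (Pi.single i 1) (Pi.single l 1)
      = - ∑ i, ∑ l, H i l * B (Pi.single i 1) (Pi.single l 1) := by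
    conv_lhs => rw [Finset.sum_comm]
    rw [← Finset.sum_neg_distrib]
    refine Finset.sum_congr rfl fun i _ => ?_
    rw [← Finset.sum_neg_distrib]
    refine Finset.sum_congr rfl fun l _ => ?_
    rw [hH l i, hanti]; ring
  have := hS
  simp only [hB] at this
  linarith

lemma det_updateRow_eq_sum {m : ℕ} (G : Matrix (Fin m) (Fin m) ℝ) (r : Fin m) (v : Fin m → ℝ) :
    (G.updateRow r v).det = ∑ l, v l * (G.updateRow r (Pi.single l 1)).det := by
  rw [Matrix.det_eq_sum_mul_adjugate_row _ r]
  refine Finset.sum_congr rfl fun l _ => ?_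
  rw [Matrix.adjugate_apply, Matrix.updateRow_self, Matrix.updateRow_idem]

/-- Piola's identity: the cofactors of a Jacobian matrix are divergence free. -/
lemma sum_partialDeriv_cofactor {m : ℕ} {a : Fin m → Euc m → ℝ}
    (ha : ∀ r, ContDiff ℝ (⊤ : ℕ∞) (a r)) (r₀ : Fin m) (x : Euc m) :
    ∑ i, fderiv ℝ (fun x => ((jac a x).updateRow r₀ (Pi.single i 1)).det) x
      (EuclideanSpace.single i 1) = 0 := by
  let f : ContinuousMultilinearMap ℝ (fun _ : Fin m => Fin m → ℝ) ℝ :=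
    ⟨(Matrix.detRowAlternating : (Fin m → ℝ) [⋀^Fin m]→ₗ[ℝ] ℝ).toMultilinearMap,
      Continuous.matrix_det continuous_id⟩
  have hf : ∀ M : Matrix (Fin m) (Fin m) ℝ, f M = M.det := fun _ => rfl
  let H : Fin m → Fin m → Fin m → ℝ := fun r i l =>
    fderiv ℝ (fun x => fderiv ℝ (a r) x (EuclideanSpace.single l 1)) x (EuclideanSpace.single i 1)
  have hd : ∀ r, Differentiable ℝ (fderiv ℝ (a r)) := fun r =>
    ((ha r).fderiv_right (m := (⊤ : ℕ∞)) (by simp)).differentiable (by simp)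
  have hH : ∀ r i l, H r i l = H r l i := by
    intro r i l
    have hsymm : IsSymmSndFDerivAt ℝ (a r) x :=
      (ha r).contDiffAt.isSymmSndFDerivAt (by
        simpa using (WithTop.coe_le_coe.2 le_top : ((2 : ℕ∞) : WithTop ℕ∞) ≤ ((⊤ : ℕ∞) : WithTop ℕ∞)))
    have e : ∀ v w : Euc m, fderiv ℝ (fun x => fderiv ℝ (a r) x v) x w
        = fderiv ℝ (fderiv ℝ (a r)) x w v := by
      intro v w
      rw [fderiv_clm_apply (hd r x) (differentiableAt_const v)]
      simp
    simp only [H, e]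
    exact hsymm _ _
  have hder : ∀ i, fderiv ℝ (fun x => ((jac a x).updateRow r₀ (Pi.single i 1)).det) x
      (EuclideanSpace.single i 1)
      = ∑ r, if r = r₀ then 0 else ∑ l, H r i l *
          (((jac a x).updateRow r₀ (Pi.single i 1)).updateRow r (Pi.single l 1)).det := by
    intro i
    let g : Fin m → Euc m → (Fin m → ℝ) := fun r x => (jac a x).updateRow r₀ (Pi.single i 1) r
    let g' : Fin m → Euc m →L[ℝ] (Fin m → ℝ) := fun r => if r = r₀ then 0 else
      ContinuousLinearMap.pi fun l =>
        fderiv ℝ (fun x => fderiv ℝ (a r) x (EuclideanSpace.single l 1)) x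
    have hg : ∀ r, HasFDerivAt (g r) (g' r) x := by
      intro r
      by_cases h : r = r₀
      · subst h
        simp only [g, g', Matrix.updateRow_self, if_true]
        exact hasFDerivAt_const _ _
      · simp only [g, g', Matrix.updateRow_ne h, if_neg h]
        refine hasFDerivAt_pi.2 fun l => ?_
        exact ((contDiff_partialDeriv (ha r) _).differentiable (by simp) x).hasFDerivAt
    have := HasFDerivAt.multilinear_comp f hg
    have e : (fun x => ((jac a x).updateRow r₀ (Pi.single i 1)).det)
        = fun x => f fun r => g r x := rfl
    rw [e, this.fderiv, sum_apply]
    refine Finset.sum_congr rfl fun r _ => ?_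
    have e2 : (f.toContinuousLinearMap (fun j => g j x) r ∘L g' r) (EuclideanSpace.single i 1)
        = (Matrix.updateRow ((jac a x).updateRow r₀ (Pi.single i 1)) r
            (g' r (EuclideanSpace.single i 1))).det := rfl
    rw [e2]
    by_cases h : r = r₀
    · simp only [g', h, if_true]
      exact Matrix.det_eq_zero_of_row_eq_zero r₀ (by simp)
    · rw [if_neg h, det_updateRow_eq_sum]
      simp only [g', if_neg h]
      rfl
  simp only [hder]
  rw [Finset.sum_comm]
  refine Finset.sum_eq_zero fun r _ => ?_
  by_cases h : r = r₀
  · simp [h]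
  · simp only [if_neg h]
    exact sum_symm_mul_det_updateRow (jac a x) h (H r) (hH r)

lemma contDiff_jac_updateRow_det {m : ℕ} {a : Fin m → Euc m → ℝ}
    (ha : ∀ r, ContDiff ℝ (⊤ : ℕ∞) (a r)) (r₀ : Fin m) (v : Fin m → ℝ) :
    ContDiff ℝ (⊤ : ℕ∞) fun x => ((jac a x).updateRow r₀ v).det := by
  simp only [Matrix.det_apply']
  refine ContDiff.sum fun σ _ => contDiff_const.mul (contDiff_prod fun r _ => ?_)
  by_cases h : σ r = r₀
  · simp only [h, Matrix.updateRow_self]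
    exact contDiff_const
  · simp only [Matrix.updateRow_ne h]
    exact contDiff_partialDeriv (ha _) _

/-- The Jacobian determinant is a divergence. -/
lemma det_jac_eq_sum_partialDeriv {m : ℕ} {a : Fin m → Euc m → ℝ}
    (ha : ∀ r, ContDiff ℝ (⊤ : ℕ∞) (a r)) (r₀ : Fin m) (x : Euc m) :
    (jac a x).det = ∑ i, fderiv ℝ
      (fun x => a r₀ x * ((jac a x).updateRow r₀ (Pi.single i 1)).det) x
        (EuclideanSpace.single i 1) := by
  have h1 : ∀ i, fderiv ℝ (fun x => a r₀ x * ((jac a x).updateRow r₀ (Pi.single i 1)).det) x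
      (EuclideanSpace.single i 1)
      = a r₀ x * fderiv ℝ (fun x => ((jac a x).updateRow r₀ (Pi.single i 1)).det) x
          (EuclideanSpace.single i 1)
        + jac a x r₀ i * ((jac a x).updateRow r₀ (Pi.single i 1)).det := by
    intro i
    rw [fderiv_fun_mul ((ha r₀).differentiable (by simp) x)
      ((contDiff_jac_updateRow_det ha r₀ _).differentiable (by simp) x)]
    simp [jac, mul_comm]
  simp only [h1]
  rw [Finset.sum_add_distrib, ← Finset.mul_sum, sum_partialDeriv_cofactor ha, mul_zero, zero_add,
    ← det_updateRow_eq_sum (jac a x) r₀ (jac a x r₀), Matrix.updateRow_eq_self]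

lemma integrableOn_discOf {n : ℕ} {g : (Fin n → ℝ) → ℝ} (hg : Continuous g) :
    IntegrableOn g (discOf n) := by
  refine (hg.continuousOn.integrableOn_compact (isCompact_closedBall 0 1)).mono_set
    (t := closedBall (0 : Fin n → ℝ) 1) (discOf_subset_closedBall n)

open Filter in
/-- Convergence to `0` on the sphere forces the flat integrals over a hemisphere to vanish. -/
lemma tendsto_integral_hemi {n : ℕ} (i : Fin (n+1)) {s : ℝ} (hs : s ^ 2 = 1) {p : ENNReal}
    (hp : 1 ≤ p) {b : ℕ → Euc (n+1) → ℝ} (hb : ∀ k, Continuous (b k)) {w : Euc (n+1) → ℝ}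
    (hw : Continuous w)
    (h : Tendsto (fun k => eLpNorm (b k) p
      ((μH[(n : ℝ)]).restrict (sphere (0 : Euc (n+1)) 1))) atTop (nhds 0)) :
    Tendsto (fun k => ∫ y in discOf n, b k (hemi n i s y) * w (hemi n i s y)) atTop (nhds 0) := by
  have hcont := continuous_hemi n i s
  obtain ⟨C, hC⟩ := (isCompact_sphere (0 : Euc (n+1)) 1).exists_bound_of_continuousOn
    hw.continuousOn
  have hbound : ∀ k, eLpNorm (fun y => b k (hemi n i s y) * w (hemi n i s y)) 1
      (volume.restrict (discOf n)) ≤ ENNReal.ofReal C *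
        (eLpNorm (b k) p ((μH[(n : ℝ)]).restrict (sphere (0 : Euc (n+1)) 1))
          * (volume.restrict (discOf n)) univ ^ (1 / (1 : ENNReal).toReal - 1 / p.toReal)) := by
    intro k
    refine (eLpNorm_le_mul_eLpNorm_of_ae_le_mul (g := fun y => b k (hemi n i s y)) (c := C) ?_ 1
      ).trans ?_
    · filter_upwards [ae_restrict_mem (measurableSet_discOf n)] with y hy
      rw [norm_mul, mul_comm]
      exact mul_le_mul_of_nonneg_right (hC _ (hemi_mem_sphere i hs hy)) (norm_nonneg _)
    · refine mul_le_mul_right ?_ _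
      refine (eLpNorm_le_eLpNorm_mul_rpow_measure_univ hp
        ((hb k).comp hcont).aestronglyMeasurable).trans ?_
      refine mul_le_mul_left ?_ _
      refine le_trans (le_of_eq ?_) (eLpNorm_mono_measure (b k) (map_hemi_le n i hs))
      exact (eLpNorm_map_measure (hb k).aestronglyMeasurable hcont.measurable.aemeasurable).symm
  have hfin : (volume.restrict (discOf n)) univ ^ (1 / (1 : ENNReal).toReal - 1 / p.toReal)
      ≠ ⊤ := by
    refine ENNReal.rpow_ne_top_of_nonneg ?_ (by simpa using (volume_discOf_lt_top n).ne)
    rcases eq_or_ne p ⊤ with rfl | hp'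
    · simp
    · have : (1 : ℝ) ≤ p.toReal := by
        simpa using ENNReal.toReal_mono hp' hp
      simpa using inv_le_one_of_one_le₀ this
  have hlim : Tendsto (fun k => ENNReal.ofReal C *
        (eLpNorm (b k) p ((μH[(n : ℝ)]).restrict (sphere (0 : Euc (n+1)) 1))
          * (volume.restrict (discOf n)) univ ^ (1 / (1 : ENNReal).toReal - 1 / p.toReal)))
      atTop (nhds 0) := by
    have := ENNReal.Tendsto.const_mul (a := ENNReal.ofReal C)
      (ENNReal.Tendsto.mul_const h (Or.inr hfin)) (Or.inr ENNReal.ofReal_ne_top)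
    simpa using this
  have := tendsto_integral_of_L1' (μ := volume.restrict (discOf n)) (0 : (Fin n → ℝ) → ℝ)
    aestronglyMeasurable_zero (F := fun k y => b k (hemi n i s y) * w (hemi n i s y)) (l := atTop)
    (Eventually.of_forall fun k => integrableOn_discOf
      (((hb k).comp hcont).mul (hw.comp hcont)))
    (by
      simp only [sub_zero]
      exact tendsto_of_tendsto_of_tendsto_of_le_of_le tendsto_const_nhds hlim
        (fun _ => zero_le) hbound)
  simpa using this

open Filter in
/-- If one component tends to `0` on the sphere while the others are fixed and smooth, then the
integral of the Jacobian determinant over the ball tends to `0`. -/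
lemma tendsto_integral_det_jac_update {n : ℕ} {p : ENNReal} (hp : 1 ≤ p)
    {a : Fin (n+1) → Euc (n+1) → ℝ} (ha : ∀ r, ContDiff ℝ (⊤ : ℕ∞) (a r)) (r₀ : Fin (n+1))
    {b : ℕ → Euc (n+1) → ℝ} (hb : ∀ k, ContDiff ℝ (⊤ : ℕ∞) (b k))
    (h : Tendsto (fun k => eLpNorm (b k) p
      ((μH[(n : ℝ)]).restrict (sphere (0 : Euc (n+1)) 1))) atTop (nhds 0)) :
    Tendsto (fun k => ∫ x in ball (0 : Euc (n+1)) 1, (jac (Function.update a r₀ (b k)) x).det)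
      atTop (nhds 0) := by
  set w : Fin (n+1) → Euc (n+1) → ℝ :=
    fun i x => ((jac a x).updateRow r₀ (Pi.single i 1)).det with hw
  have hwc : ∀ i, ContDiff ℝ (⊤ : ℕ∞) (w i) := fun i => contDiff_jac_updateRow_det ha r₀ _
  have hc : ∀ k i, ContDiff ℝ 1 fun x => b k x * w i x := fun k i =>
    ((hb k).mul (hwc i)).of_le (by simp)
  have e : ∀ k, ∫ x in ball (0 : Euc (n+1)) 1, (jac (Function.update a r₀ (b k)) x).det
      = ∑ i, ((∫ y in discOf n, b k (hemi n i 1 y) * w i (hemi n i 1 y))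
          - ∫ y in discOf n, b k (hemi n i (-1) y) * w i (hemi n i (-1) y)) := by
    intro k
    have hab : ∀ r, ContDiff ℝ (⊤ : ℕ∞) (Function.update a r₀ (b k) r) := by
      intro r
      by_cases h : r = r₀
      · subst h; simpa using hb k
      · simpa [Function.update_of_ne h] using ha r
    simp only [det_jac_eq_sum_partialDeriv hab r₀, Function.update_self, jac_update_updateRow]
    rw [integral_finsetSum]
    · refine Finset.sum_congr rfl fun i _ => ?_
      rw [integral_ball_partialDeriv i (hc k i), integral_sub]
      · exact integrableOn_discOf ((hc k i).continuous.comp (continuous_hemi n i 1))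
      · exact integrableOn_discOf ((hc k i).continuous.comp (continuous_hemi n i (-1)))
    · intro i _
      refine IntegrableOn.mono_set (ContinuousOn.integrableOn_compact
        (isCompact_closedBall (0 : Euc (n+1)) 1) ?_) ball_subset_closedBall
      exact ((((hc k i).continuous_fderiv one_ne_zero).clm_apply continuous_const)).continuousOn
  simp only [e]
  have := tendsto_finsetSum (Finset.univ : Finset (Fin (n+1))) fun i _ =>
    (tendsto_integral_hemi i (s := 1) (by norm_num) hp (fun k => (hb k).continuous)
      (hwc i).continuous h).sub
    (tendsto_integral_hemi i (s := -1) (by norm_num) hp (fun k => (hb k).continuous)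
      (hwc i).continuous h)
  simpa using this

/-- The field `A` on the unit ball is the limit in `L^{n+1}` of gradients of smooth functions whose
restrictions to the sphere converge to `b` in `L^{n+1}`. -/
def IsGradientWithTrace (n : ℕ) (A : Fin (n+1) → Euc (n+1) → ℝ) (b : Euc (n+1) → ℝ) : Prop :=
  (∀ i, MemLp (A i) ((n+1 : ℕ) : ENNReal) (volume.restrict (ball (0 : Euc (n+1)) 1))) ∧
  ∃ a : ℕ → Euc (n+1) → ℝ, (∀ k, ContDiff ℝ (⊤ : ℕ∞) (a k)) ∧
    (∀ i, Filter.Tendsto (fun k => eLpNorm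
      (fun x => fderiv ℝ (a k) x (EuclideanSpace.single i 1) - A i x) ((n+1 : ℕ) : ENNReal)
      (volume.restrict (ball (0 : Euc (n+1)) 1))) Filter.atTop (nhds 0)) ∧
    Filter.Tendsto (fun k => eLpNorm (fun x => a k x - b x) ((n+1 : ℕ) : ENNReal)
      ((μH[(n : ℝ)]).restrict (sphere (0 : Euc (n+1)) 1))) Filter.atTop (nhds 0)

lemma memLp_ball_of_continuous {m : ℕ} {g : Euc m → ℝ} (hg : Continuous g) (p : ENNReal) :
    MemLp g p (volume.restrict (ball (0 : Euc m) 1)) := by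
  obtain ⟨C, hC⟩ := (isCompact_closedBall (0 : Euc m) 1).exists_bound_of_continuousOn
    hg.continuousOn
  have : IsFiniteMeasure (volume.restrict (ball (0 : Euc m) 1)) :=
    ⟨by simpa using measure_ball_lt_top⟩
  refine MemLp.of_bound hg.aestronglyMeasurable C ?_
  filter_upwards [ae_restrict_mem measurableSet_ball] with x hx
  exact hC x (ball_subset_closedBall hx)

lemma continuous_partialDeriv {m : ℕ} {a : Euc m → ℝ} (ha : ContDiff ℝ (⊤ : ℕ∞) a) (v : Euc m) :
    Continuous fun x => fderiv ℝ a x v :=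
  (contDiff_partialDeriv ha v).continuous

open Filter in
lemma tendsto_eLpNorm_sub_of_tendsto {α : Type*} [MeasurableSpace α] {μ : Measure α}
    {p : ENNReal} (hp : 1 ≤ p) {F G : ℕ → α → ℝ} {f g : α → ℝ}
    (hFm : ∀ k, AEStronglyMeasurable (fun x => F k x - f x) μ)
    (hGm : ∀ k, AEStronglyMeasurable (fun x => G k x - g x) μ)
    (hF : Tendsto (fun k => eLpNorm (fun x => F k x - f x) p μ) atTop (nhds 0))
    (hG : Tendsto (fun k => eLpNorm (fun x => G k x - g x) p μ) atTop (nhds 0)) :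
    Tendsto (fun k => eLpNorm (fun x => (F k x - G k x) - (f x - g x)) p μ) atTop (nhds 0) := by
  refine tendsto_of_tendsto_of_tendsto_of_le_of_le tendsto_const_nhds
    (by simpa using hF.add hG) (fun _ => zero_le) fun k => ?_
  refine le_trans (le_of_eq ?_) (eLpNorm_sub_le (hFm k) (hGm k) hp)
  congr 1
  funext x
  simp only [Pi.sub_apply]
  ring

lemma IsGradientWithTrace.of_contDiff {n : ℕ} {b : Euc (n+1) → ℝ} (hb : ContDiff ℝ (⊤ : ℕ∞) b) :
    IsGradientWithTrace n (fun i x => fderiv ℝ b x (EuclideanSpace.single i 1)) b :=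
  ⟨fun _ => memLp_ball_of_continuous (continuous_partialDeriv hb _) _, fun _ => b, fun _ => hb,
    fun i => by simp, by simp⟩

lemma IsGradientWithTrace.sub {n : ℕ} {A A' : Fin (n+1) → Euc (n+1) → ℝ} {b b' : Euc (n+1) → ℝ}
    (h : IsGradientWithTrace n A b) (h' : IsGradientWithTrace n A' b')
    (hb : Continuous b) (hb' : Continuous b') :
    IsGradientWithTrace n (fun i x => A i x - A' i x) (fun x => b x - b' x) := by
  obtain ⟨hA, a, ha, hd, ht⟩ := h
  obtain ⟨hA', a', ha', hd', ht'⟩ := h'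
  have h1 : (1 : ENNReal) ≤ ((n+1 : ℕ) : ENNReal) := by simp
  refine ⟨fun i => (hA i).sub (hA' i), fun k x => a k x - a' k x, fun k => (ha k).sub (ha' k),
    fun i => ?_, ?_⟩
  · have := tendsto_eLpNorm_sub_of_tendsto h1
      (fun k => (continuous_partialDeriv (ha k) _).aestronglyMeasurable.sub (hA i).1)
      (fun k => (continuous_partialDeriv (ha' k) _).aestronglyMeasurable.sub (hA' i).1)
      (hd i) (hd' i)
    refine this.congr fun k => ?_
    congr 1
    funext x
    rw [fderiv_fun_sub ((ha k).differentiable (by simp) x) ((ha' k).differentiable (by simp) x)]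
    simp
  · exact tendsto_eLpNorm_sub_of_tendsto h1
      (fun k => ((ha k).continuous.sub hb).aestronglyMeasurable)
      (fun k => ((ha' k).continuous.sub hb').aestronglyMeasurable) ht ht'

open Filter in
/-- The determinant is a null Lagrangian: it integrates to zero if one row has zero trace. -/
lemma integral_det_eq_zero_of_trace_eq_zero {n : ℕ} {A : Fin (n+1) → Fin (n+1) → Euc (n+1) → ℝ}
    {b : Fin (n+1) → Euc (n+1) → ℝ} (hA : ∀ r, IsGradientWithTrace n (A r) (b r))
    (r₀ : Fin (n+1)) (hr₀ : b r₀ = fun _ => 0) :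
    ∫ x in ball (0 : Euc (n+1)) 1, (Matrix.of fun r i => A r i x).det = 0 := by
  have h1 : (1 : ENNReal) ≤ ((n+1 : ℕ) : ENNReal) := by simp
  choose hm a ha hd ht using hA
  have hjac : ∀ (c : Fin (n+1) → Euc (n+1) → ℝ), (∀ r, ContDiff ℝ (⊤ : ℕ∞) (c r)) → ∀ r i,
      MemLp (fun x => jac c x r i) ((n+1 : ℕ) : ENNReal)
        (volume.restrict (ball (0 : Euc (n+1)) 1)) := fun c hc r i =>
    memLp_ball_of_continuous (continuous_partialDeriv (hc r) _) _
  have hupd : ∀ j k r, ContDiff ℝ (⊤ : ℕ∞) (Function.update (fun r => a r j) r₀ (a r₀ k) r) := by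
    intro j k r
    by_cases h : r = r₀
    · subst h; simpa using ha r k
    · simpa [Function.update_of_ne h] using ha r j
  have hmem : ∀ j r i, MemLp (fun x => ((jac (fun r => a r j) x).updateRow r₀
      (fun i => A r₀ i x)) r i) ((n+1 : ℕ) : ENNReal)
        (volume.restrict (ball (0 : Euc (n+1)) 1)) := by
    intro j r i
    by_cases h : r = r₀
    · subst h; simpa using hm r i
    · simpa [Matrix.updateRow_ne h] using hjac (fun r => a r j) (fun r => ha r j) r i
  have hzero : ∀ j, ∫ x in ball (0 : Euc (n+1)) 1,
      ((jac (fun r => a r j) x).updateRow r₀ (fun i => A r₀ i x)).det = 0 := by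
    intro j
    refine tendsto_nhds_unique (tendsto_integral_det n.succ_ne_zero
      (fun k => hjac _ (hupd j k)) (hmem j) fun r i => ?_)
      (tendsto_integral_det_jac_update h1 (fun r => ha r j) r₀ (fun k => ha r₀ k) ?_)
    · by_cases h : r = r₀
      · subst h
        simpa [jac] using hd r i
      · simp [Matrix.updateRow_ne h, jac, Function.update_of_ne h]
    · simpa [hr₀] using ht r₀
  refine (tendsto_nhds_unique (tendsto_integral_det n.succ_ne_zero hmem
    (N := fun x => Matrix.of fun r i => A r i x) (fun r i => hm r i) fun r i => ?_)
    (by simp only [hzero]; exact tendsto_const_nhds))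
  by_cases h : r = r₀
  · subst h
    simp
  · simpa [Matrix.updateRow_ne h, jac] using hd r i

/-- The integral of the determinant only depends on the traces. -/
lemma integral_det_eq_integral_det_jac {n : ℕ} {A : Fin (n+1) → Fin (n+1) → Euc (n+1) → ℝ}
    {b : Fin (n+1) → Euc (n+1) → ℝ} (hA : ∀ r, IsGradientWithTrace n (A r) (b r))
    (hb : ∀ r, ContDiff ℝ (⊤ : ℕ∞) (b r)) :
    ∫ x in ball (0 : Euc (n+1)) 1, (Matrix.of fun r i => A r i x).det
      = ∫ x in ball (0 : Euc (n+1)) 1, (jac b x).det := by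
  let D : Fin (n+1) → Fin (n+1) → Euc (n+1) → ℝ :=
    fun r i x => fderiv ℝ (b r) x (EuclideanSpace.single i 1)
  have hD : ∀ r, IsGradientWithTrace n (D r) (b r) := fun r => .of_contDiff (hb r)
  have key : ∀ s : Finset (Fin (n+1)),
      ∫ x in ball (0 : Euc (n+1)) 1, (Matrix.of fun r i => if r ∈ s then D r i x else A r i x).det
        = ∫ x in ball (0 : Euc (n+1)) 1, (Matrix.of fun r i => A r i x).det := by
    intro s
    induction s using Finset.induction_on with
    | empty => simp
    | insert r₀ s hr₀ ih =>
      rw [← ih, ← sub_eq_zero]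
      set M : Euc (n+1) → Matrix (Fin (n+1)) (Fin (n+1)) ℝ := fun x =>
        Matrix.of fun r i => if r ∈ s then D r i x else A r i x with hM
      have hMr : ∀ r i, MemLp (fun x => M x r i) ((n+1 : ℕ) : ENNReal)
          (volume.restrict (ball (0 : Euc (n+1)) 1)) := by
        intro r i
        by_cases h : r ∈ s
        · simpa [hM, h] using (hD r).1 i
        · simpa [hM, h] using (hA r).1 i
      have e1 : ∀ x, (Matrix.of fun r i => if r ∈ insert r₀ s then D r i x else A r i x)
          = (M x).updateRow r₀ (fun i => D r₀ i x) := by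
        intro x
        ext r i
        by_cases h : r = r₀
        · subst h; simp
        · simp [hM, h]
      have e2 : ∀ x, M x = (M x).updateRow r₀ (fun i => A r₀ i x) := by
        intro x
        ext r i
        by_cases h : r = r₀
        · subst h; simp [hM, hr₀]
        · simp [Matrix.updateRow_ne h]
      have hU : ∀ r i, MemLp (fun x => (M x).updateRow r₀ (fun i => D r₀ i x) r i)
          ((n+1 : ℕ) : ENNReal) (volume.restrict (ball (0 : Euc (n+1)) 1)) := by
        intro r i
        by_cases h : r = r₀
        · subst h; simpa using (hD r).1 i
        · simpa [Matrix.updateRow_ne h] using hMr r i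
      simp only [e1]
      rw [← integral_sub (integrable_det_of_memLp n.succ_ne_zero hU)
        (integrable_det_of_memLp n.succ_ne_zero hMr)]
      let A' : Fin (n+1) → Fin (n+1) → Euc (n+1) → ℝ := fun r i x =>
        if r = r₀ then D r i x - A r i x else if r ∈ s then D r i x else A r i x
      let b' : Fin (n+1) → Euc (n+1) → ℝ := fun r x => if r = r₀ then b r x - b r x else b r x
      have hA' : ∀ r, IsGradientWithTrace n (A' r) (b' r) := by
        intro r
        by_cases h : r = r₀
        · simp only [A', b', h, if_true]
          exact (hD r₀).sub (hA r₀) (hb r₀).continuous (hb r₀).continuous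
        · by_cases h' : r ∈ s
          · simpa only [A', b', h, h', if_true, if_false] using hD r
          · simpa only [A', b', h, h', if_true, if_false] using hA r
      rw [← integral_det_eq_zero_of_trace_eq_zero hA' r₀ (by funext x; simp [b'])]
      refine integral_congr_ae (Filter.Eventually.of_forall fun x => ?_)
      have e3 : (Matrix.of fun r i => A' r i x)
          = (M x).updateRow r₀ ((fun i => D r₀ i x) - fun i => A r₀ i x) := by
        ext r i
        by_cases h : r = r₀
        · subst h; simp [A']
        · simp [A', hM, h]
      have e4 := Matrix.det_updateRow_add (M x) r₀ ((fun i => D r₀ i x) - fun i => A r₀ i x)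
        (fun i => A r₀ i x)
      rw [sub_add_cancel, ← e2 x] at e4
      simp only [e3]
      linarith
  rw [← key Finset.univ]
  simp only [Finset.mem_univ, if_true]
  rfl

lemma lintegral_comp_smul_sub {m : ℕ} {G : Euc m → ENNReal} (hG : Measurable G) {l : ℝ}
    (hl : 0 < l) (t : Euc m) :
    ∫⁻ x, G (l • x - t) = ENNReal.ofReal ((l ^ m)⁻¹) * ∫⁻ x, G x := by
  have h1 : ∫⁻ x, G (l • x - t) = ∫⁻ y, G (y - t) ∂(volume.map fun x : Euc m => l • x) :=
    (lintegral_map (hG.comp (measurable_id.sub_const t)) (measurable_const_smul l)).symm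
  rw [h1, Measure.map_addHaar_smul _ hl.ne', lintegral_smul_measure,
    lintegral_sub_right_eq_self G t]
  simp [abs_of_pos hl]

/-- The `L^p` bound for convolution with a probability density, composed with a dilation. -/
lemma eLpNorm_convolution_smul_le {m : ℕ} {p : ENNReal} (hp : 1 ≤ p) (hp' : p ≠ ⊤)
    {ρ : Euc m → ℝ} (hρc : Continuous ρ) (hρ0 : ∀ t, 0 ≤ ρ t) (hρi : Integrable ρ)
    (hρ : ∫ t, ρ t = 1) {w : Euc m → ℝ} (hw : AEStronglyMeasurable w) {l : ℝ} (hl : 0 < l) :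
    eLpNorm (fun x => ∫ t, ρ t * w (l • x - t)) p volume
      ≤ ENNReal.ofReal ((l ^ m)⁻¹) ^ (1 / p.toReal) * eLpNorm w p volume := by
  wlog hwm : Measurable w generalizing w
  · have e : ∀ x, ∫ t, ρ t * w (l • x - t) = ∫ t, ρ t * hw.mk w (l • x - t) := by
      intro x
      refine integral_congr_ae ?_
      have := (quasiMeasurePreserving_sub_left (volume : Measure (Euc m)) (l • x)).ae hw.ae_eq_mk
      filter_upwards [this] with t ht
      rw [ht]
    simp only [e]
    rw [eLpNorm_congr_ae hw.ae_eq_mk]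
    exact this hw.stronglyMeasurable_mk.aestronglyMeasurable hw.stronglyMeasurable_mk.measurable
  have hp0 : p ≠ 0 := (zero_lt_one.trans_le hp).ne'
  have hpr : 0 < p.toReal := ENNReal.toReal_pos hp0 hp'
  have hdm : Measurable fun t => ENNReal.ofReal (ρ t) := hρc.measurable.ennreal_ofReal
  have hd1 : ∫⁻ t, ENNReal.ofReal (ρ t) = 1 := by
    rw [← ofReal_integral_eq_lintegral_ofReal hρi (Filter.Eventually.of_forall hρ0), hρ,
      ENNReal.ofReal_one]
  have hprob : IsProbabilityMeasure (volume.withDensity fun t => ENNReal.ofReal (ρ t)) :=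
    ⟨by rw [withDensity_apply _ MeasurableSet.univ, Measure.restrict_univ, hd1]⟩
  have hpt : ∀ x, ‖∫ t, ρ t * w (l • x - t)‖ₑ ^ p.toReal
      ≤ ∫⁻ t, ENNReal.ofReal (ρ t) * ‖w (l • x - t)‖ₑ ^ p.toReal := by
    intro x
    have hgm : Measurable fun t => w (l • x - t) := hwm.comp (measurable_const.sub measurable_id)
    have h1 : ‖∫ t, ρ t * w (l • x - t)‖ₑ ≤ eLpNorm (fun t => w (l • x - t)) 1
        (volume.withDensity fun t => ENNReal.ofReal (ρ t)) := by
      refine (enorm_integral_le_lintegral_enorm _).trans (le_of_eq ?_)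
      rw [eLpNorm_one_eq_lintegral_enorm, lintegral_withDensity_eq_lintegral_mul _ hdm hgm.enorm]
      refine lintegral_congr fun t => ?_
      rw [Pi.mul_apply, enorm_mul, Real.enorm_of_nonneg (hρ0 t)]
    have h2 := h1.trans (eLpNorm_le_eLpNorm_of_exponent_le hp hgm.aestronglyMeasurable)
    rw [eLpNorm_eq_lintegral_rpow_enorm_toReal hp0 hp',
      lintegral_withDensity_eq_lintegral_mul _ hdm (hgm.enorm.pow_const _)] at h2
    have h3 := ENNReal.rpow_le_rpow h2 hpr.le
    rwa [← ENNReal.rpow_mul, one_div_mul_cancel hpr.ne', ENNReal.rpow_one] at h3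
  rw [eLpNorm_eq_lintegral_rpow_enorm_toReal hp0 hp',
    eLpNorm_eq_lintegral_rpow_enorm_toReal hp0 hp', ← ENNReal.mul_rpow_of_nonneg _ _ (by positivity)]
  refine ENNReal.rpow_le_rpow ?_ (by positivity)
  refine (lintegral_mono hpt).trans (le_of_eq ?_)
  rw [lintegral_lintegral_swap]
  · have : ∀ t, ∫⁻ x, ENNReal.ofReal (ρ t) * ‖w (l • x - t)‖ₑ ^ p.toReal
        = ENNReal.ofReal (ρ t) * (ENNReal.ofReal ((l ^ m)⁻¹) * ∫⁻ x, ‖w x‖ₑ ^ p.toReal) := by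
      intro t
      rw [lintegral_const_mul, lintegral_comp_smul_sub (hwm.enorm.pow_const p.toReal) hl]
      exact (hwm.comp ((measurable_const_smul l).sub_const t)).enorm.pow_const _
    simp only [this]
    rw [lintegral_mul_const _ hdm, hd1, one_mul]
  · refine Measurable.aemeasurable ?_
    refine (hdm.comp measurable_snd).mul ?_
    exact (hwm.comp (((measurable_const_smul l).comp measurable_fst).sub measurable_snd)).enorm.pow_const _

/-- A sequence of smooth bumps shrinking to the origin. -/
def shrinkingBump (m k : ℕ) : ContDiffBump (0 : Euc m) where
  rIn := 1 / (2 * ((k : ℝ) + 3))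
  rOut := 1 / ((k : ℝ) + 3)
  rIn_pos := by positivity
  rIn_lt_rOut := by
    have : (0 : ℝ) < (k : ℝ) + 3 := by positivity
    exact one_div_lt_one_div_of_lt this (by linarith)

/-- The mollifier associated with `shrinkingBump`. -/
def mollifier (m k : ℕ) : Euc m → ℝ := (shrinkingBump m k).normed volume

/-- The dilation factor that keeps the mollified functions inside the unit ball. -/
def dilation (k : ℕ) : ℝ := 1 - 2 / ((k : ℝ) + 3)

/-- Mollification of `w` precomposed with a contraction. -/
def mollify (m k : ℕ) (w : Euc m → ℝ) (x : Euc m) : ℝ :=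
  ∫ t, mollifier m k t * w (dilation k • x - t)

lemma one_third_le_dilation (k : ℕ) : 1 / 3 ≤ dilation k := by
  have : (2 : ℝ) / ((k : ℝ) + 3) ≤ 2 / 3 := by gcongr; linarith [(Nat.cast_nonneg k : (0 : ℝ) ≤ k)]
  unfold dilation
  linarith

lemma dilation_pos (k : ℕ) : 0 < dilation k := by linarith [one_third_le_dilation k]

open Filter in
lemma tendsto_one_div_add_three : Tendsto (fun k : ℕ => 1 / ((k : ℝ) + 3)) atTop (nhds 0) := by
  have : Tendsto (fun k : ℕ => (k : ℝ) + 3) atTop atTop :=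
    tendsto_atTop_add_const_right _ _ tendsto_natCast_atTop_atTop
  simp only [one_div]
  exact this.inv_tendsto_atTop

open Filter in
lemma tendsto_dilation : Tendsto dilation atTop (nhds 1) := by
  have : Tendsto (fun k : ℕ => 1 - 2 * (1 / ((k : ℝ) + 3))) atTop (nhds (1 - 2 * 0)) :=
    tendsto_const_nhds.sub (tendsto_one_div_add_three.const_mul 2)
  have e : dilation = fun k : ℕ => 1 - 2 * (1 / ((k : ℝ) + 3)) := by
    funext k
    unfold dilation
    ring
  rw [e]
  simpa using this

lemma continuous_mollifier (m k : ℕ) : Continuous (mollifier m k) :=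
  (shrinkingBump m k).continuous_normed

lemma contDiff_mollifier (m k : ℕ) : ContDiff ℝ (⊤ : ℕ∞) (mollifier m k) :=
  (shrinkingBump m k).contDiff_normed

lemma hasCompactSupport_mollifier (m k : ℕ) : HasCompactSupport (mollifier m k) :=
  (shrinkingBump m k).hasCompactSupport_normed

lemma eLpNorm_mollify_le {m : ℕ} {p : ENNReal} (hp : 1 ≤ p) (hp' : p ≠ ⊤) {w : Euc m → ℝ}
    (hw : AEStronglyMeasurable w) (k : ℕ) :
    eLpNorm (mollify m k w) p volume
      ≤ ENNReal.ofReal (((1 / 3 : ℝ) ^ m)⁻¹) ^ (1 / p.toReal) * eLpNorm w p volume := by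
  refine (eLpNorm_convolution_smul_le hp hp' (continuous_mollifier m k)
    (shrinkingBump m k).nonneg_normed (shrinkingBump m k).integrable_normed
    (shrinkingBump m k).integral_normed hw (dilation_pos k)).trans ?_
  gcongr
  exact one_third_le_dilation k

open Filter in
lemma tendsto_mollify_of_continuous {m : ℕ} (p : ENNReal) {g : Euc m → ℝ} (hg : Continuous g)
    (hgs : HasCompactSupport g) :
    Tendsto (fun k => eLpNorm (fun x => mollify m k g x - g x) p
      (volume.restrict (ball (0 : Euc m) 1))) atTop (nhds 0) := by
  set V : ENNReal := (volume.restrict (ball (0 : Euc m) 1)) univ ^ p.toReal⁻¹ with hV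
  have hVt : V ≠ ⊤ := ENNReal.rpow_ne_top_of_nonneg (by positivity)
    (by simpa using measure_ball_lt_top.ne)
  refine ENNReal.tendsto_nhds_zero.2 fun ε hε => ?_
  have hlim : Tendsto (fun s : ℝ => V * ENNReal.ofReal s) (nhdsWithin 0 (Ioi 0)) (nhds 0) := by
    have : Tendsto (fun s : ℝ => ENNReal.ofReal s) (nhdsWithin 0 (Ioi 0)) (nhds 0) := by
      simpa using (ENNReal.continuous_ofReal.tendsto 0).mono_left nhdsWithin_le_nhds
    simpa using ENNReal.Tendsto.const_mul this (Or.inr hVt)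
  obtain ⟨s, hs, hs0⟩ := ((ENNReal.tendsto_nhds_zero.1 hlim ε hε).and self_mem_nhdsWithin).exists
  obtain ⟨δ, hδ, hgδ⟩ := Metric.uniformContinuous_iff.1 (hgs.uniformContinuous_of_continuous hg) s hs0
  have h3 : Tendsto (fun k : ℕ => 3 * (1 / ((k : ℝ) + 3))) atTop (nhds 0) := by
    simpa using tendsto_one_div_add_three.const_mul 3
  filter_upwards [h3.eventually_lt_const hδ] with k hk
  refine (eLpNorm_le_of_ae_bound (C := s) ?_).trans hs
  filter_upwards [ae_restrict_mem measurableSet_ball] with x hx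
  rw [← dist_eq_norm]
  refine dist_convolution_le (R := 1 / ((k : ℝ) + 3)) (f := mollifier m k) (le_of_lt hs0)
    (shrinkingBump m k).support_normed_eq.subset
    (shrinkingBump m k).nonneg_normed (shrinkingBump m k).integral_normed
    hg.aestronglyMeasurable fun y hy => (hgδ (lt_of_le_of_lt ?_ hk)).le
  have h1 : dist (dilation k • x) x ≤ 2 * (1 / ((k : ℝ) + 3)) := by
    have : dilation k • x - x = -(2 * (1 / ((k : ℝ) + 3))) • x := by
      unfold dilation
      module
    rw [dist_eq_norm, this, norm_smul, Real.norm_eq_abs, abs_neg, abs_of_nonneg (by positivity)]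
    exact mul_le_of_le_one_right (by positivity) (mem_ball_zero_iff.1 hx).le
  have h2 := dist_triangle y (dilation k • x) x
  have h4 := mem_ball.1 hy
  linarith

lemma mollify_sub {m k : ℕ} {w g : Euc m → ℝ} (hw : LocallyIntegrable w)
    (hg : LocallyIntegrable g) (x : Euc m) :
    mollify m k (fun y => w y - g y) x = mollify m k w x - mollify m k g x := by
  have h : ∀ {w : Euc m → ℝ}, LocallyIntegrable w →
      Integrable fun t => mollifier m k t * w (dilation k • x - t) := fun hw =>
    (hasCompactSupport_mollifier m k).convolutionExists_left (ContinuousLinearMap.lsmul ℝ ℝ)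
      (continuous_mollifier m k) hw (dilation k • x)
  unfold mollify
  rw [← integral_sub (h hw) (h hg)]
  simp only [mul_sub]

open Filter in
/-- Mollifications converge in `L^p` on the ball. -/
lemma tendsto_mollify {m : ℕ} {p : ENNReal} (hp : 1 ≤ p) (hp' : p ≠ ⊤) {w : Euc m → ℝ}
    (hw : MemLp w p volume) :
    Tendsto (fun k => eLpNorm (fun x => mollify m k w x - w x) p
      (volume.restrict (ball (0 : Euc m) 1))) atTop (nhds 0) := by
  set C : ENNReal := ENNReal.ofReal (((1 / 3 : ℝ) ^ m)⁻¹) ^ (1 / p.toReal) with hC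
  have hCt : C ≠ ⊤ := ENNReal.rpow_ne_top_of_nonneg (by positivity) ENNReal.ofReal_ne_top
  refine ENNReal.tendsto_nhds_zero.2 fun ε hε => ?_
  have hη : ε / 2 / (C + 1) ≠ 0 := by
    simp [ENNReal.div_eq_zero_iff, hε.ne', hCt]
  obtain ⟨g, hgs, hgw, hgc, hgm⟩ := hw.exists_hasCompactSupport_eLpNorm_sub_le hp' hη
  have hwl := hw.locallyIntegrable hp
  have hgl := hgm.locallyIntegrable hp
  filter_upwards [ENNReal.tendsto_nhds_zero.1 (tendsto_mollify_of_continuous p hgc hgs) (ε / 2)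
    (ENNReal.half_pos hε.ne')] with k hk
  have hmeas : ∀ {w : Euc m → ℝ}, LocallyIntegrable w → AEStronglyMeasurable (mollify m k w)
      (volume.restrict (ball (0 : Euc m) 1)) := fun hw =>
    (((hasCompactSupport_mollifier m k).continuous_convolution_left
      (ContinuousLinearMap.lsmul ℝ ℝ) (continuous_mollifier m k) hw).comp
        (continuous_const_smul (dilation k))).aestronglyMeasurable
  have hwg : AEStronglyMeasurable (fun x => w x - g x) volume := hw.1.sub hgm.1
  have e : (fun x => mollify m k w x - w x) =
      (mollify m k (fun y => w y - g y) + fun x => mollify m k g x - g x)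
        - fun x => w x - g x := by
    funext x
    simp only [Pi.add_apply, Pi.sub_apply, mollify_sub hwl hgl]
    ring
  have m1 := hmeas (hwl.sub hgl)
  have m2 := (hmeas hgl).sub hgm.1.restrict
  calc eLpNorm (fun x => mollify m k w x - w x) p (volume.restrict (ball (0 : Euc m) 1))
      ≤ (eLpNorm (mollify m k (fun y => w y - g y)) p (volume.restrict (ball (0 : Euc m) 1))
        + eLpNorm (fun x => mollify m k g x - g x) p (volume.restrict (ball (0 : Euc m) 1)))
        + eLpNorm (fun x => w x - g x) p (volume.restrict (ball (0 : Euc m) 1)) := by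
        rw [e]
        refine (eLpNorm_sub_le (m1.add m2) hwg.restrict hp).trans ?_
        gcongr
        exact eLpNorm_add_le m1 m2 hp
    _ ≤ (C * (ε / 2 / (C + 1)) + ε / 2) + ε / 2 / (C + 1) := by
        have hgw' : eLpNorm (fun x => w x - g x) p volume ≤ ε / 2 / (C + 1) := hgw
        gcongr
        · refine (eLpNorm_mono_measure _ Measure.restrict_le_self).trans ?_
          refine (eLpNorm_mollify_le hp hp' hwg k).trans ?_
          gcongr
        · exact (eLpNorm_mono_measure _ Measure.restrict_le_self).trans hgw'
    _ = (C + 1) * (ε / 2 / (C + 1)) + ε / 2 := by ring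
    _ = ε := by
        rw [ENNReal.mul_div_cancel (by simp) (by simp [hCt]), ENNReal.add_halves]

lemma contDiff_mollify {m : ℕ} (k : ℕ) {w : Euc m → ℝ} (hw : LocallyIntegrable w) :
    ContDiff ℝ (⊤ : ℕ∞) (mollify m k w) :=
  ((hasCompactSupport_mollifier m k).contDiff_convolution_left (ContinuousLinearMap.lsmul ℝ ℝ)
    (contDiff_mollifier m k) hw).comp (contDiff_const_smul (dilation k))

lemma fderiv_mollify {m : ℕ} (k : ℕ) {w : Euc m → ℝ} (hw : LocallyIntegrable w) (x e : Euc m) :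
    fderiv ℝ (mollify m k w) x e
      = dilation k * ∫ y, w y * fderiv ℝ (mollifier m k) (dilation k • x - y) e := by
  have h1 : ContDiff ℝ 1 (mollifier m k) := (contDiff_mollifier m k).of_le (by simp)
  have hd := (hasCompactSupport_mollifier m k).hasFDerivAt_convolution_left
    (ContinuousLinearMap.lsmul ℝ ℝ) h1 hw (dilation k • x)
  have hs : HasFDerivAt (fun x : Euc m => dilation k • x)
      (dilation k • ContinuousLinearMap.id ℝ (Euc m)) x := 
    (dilation k • ContinuousLinearMap.id ℝ (Euc m)).hasFDerivAt
  have hc : HasFDerivAt (mollify m k w) _ x := hd.comp x hs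
  rw [hc.fderiv]
  simp only [ContinuousLinearMap.comp_apply, smul_apply,
    ContinuousLinearMap.id_apply, map_smul, smul_eq_mul]
  congr 1
  have hi : Integrable fun t => ((ContinuousLinearMap.lsmul ℝ ℝ).precompL (Euc m)
      (fderiv ℝ (mollifier m k) t)) (w (dilation k • x - t)) :=
    ((hasCompactSupport_mollifier m k).fderiv ℝ).convolutionExists_left _
      (h1.continuous_fderiv one_ne_zero) hw (dilation k • x)
  rw [convolution_def, ContinuousLinearMap.integral_apply hi]
  rw [← integral_sub_left_eq_self _ volume (dilation k • x)]
  refine integral_congr_ae (Filter.Eventually.of_forall fun y => ?_)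
  simp [ContinuousLinearMap.precompL_apply, mul_comm]

/-- Inside the ball, mollification commutes with weak differentiation. -/
lemma fderiv_mollify_indicator {m : ℕ} (k : ℕ) {u v : Euc m → ℝ} {i : Fin m}
    (hu : IntegrableOn u (ball (0 : Euc m) 1))
    (h : IsWeakPartialDeriv m (ball (0 : Euc m) 1) u i v) {x : Euc m}
    (hx : x ∈ ball (0 : Euc m) 1) :
    fderiv ℝ (mollify m k ((ball (0 : Euc m) 1).indicator u)) x (EuclideanSpace.single i 1)
      = dilation k * mollify m k ((ball (0 : Euc m) 1).indicator v) x := by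
  rw [fderiv_mollify k (hu.integrable_indicator measurableSet_ball).locallyIntegrable]
  congr 1
  set z := dilation k • x with hz
  let φ : Euc m → ℝ := fun y => mollifier m k (z - y)
  have hφ : ContDiff ℝ (⊤ : ℕ∞) φ := (contDiff_mollifier m k).comp (contDiff_const.sub contDiff_id)
  have hδ : (0 : ℝ) < 1 / ((k : ℝ) + 3) := by positivity
  have hzn : ‖z‖ ≤ 1 - 2 * (1 / ((k : ℝ) + 3)) := by
    rw [hz, norm_smul, Real.norm_eq_abs, abs_of_pos (dilation_pos k)]
    refine (mul_le_of_le_one_right (dilation_pos k).le (mem_ball_zero_iff.1 hx).le).trans ?_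
    unfold dilation
    rw [mul_one_div]
  have hts : tsupport φ ⊆ closedBall z (1 / ((k : ℝ) + 3)) := by
    refine closure_minimal (fun y hy => ?_) isClosed_closedBall
    have : z - y ∈ Function.support (mollifier m k) := hy
    rw [mollifier, ContDiffBump.support_normed_eq, mem_ball_zero_iff] at this
    rw [mem_closedBall, dist_comm, dist_eq_norm]
    exact this.le
  have hφs : HasCompactSupport φ := (isCompact_closedBall z _).of_isClosed_subset
    (isClosed_tsupport φ) hts
  have hφB : tsupport φ ⊆ ball (0 : Euc m) 1 := by
    refine hts.trans fun y hy => ?_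
    rw [mem_ball_zero_iff]
    rw [mem_closedBall, dist_eq_norm] at hy
    have := norm_le_norm_add_norm_sub' y z
    linarith
  have hw := h φ hφ hφs hφB
  have hφd : ∀ y, fderiv ℝ φ y (EuclideanSpace.single i 1)
      = - fderiv ℝ (mollifier m k) (z - y) (EuclideanSpace.single i 1) := by
    intro y
    have h1 : HasFDerivAt (fun y => z - y) (-ContinuousLinearMap.id ℝ (Euc m)) y :=
      (hasFDerivAt_id y).const_sub z
    have h2 : HasFDerivAt φ _ y := (((contDiff_mollifier m k).differentiable (by simp)
      (z - y)).hasFDerivAt).comp y h1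
    rw [h2.fderiv]
    simp
  have e1 : ∫ y, (ball (0 : Euc m) 1).indicator u y
        * fderiv ℝ (mollifier m k) (z - y) (EuclideanSpace.single i 1)
      = - ∫ y in ball (0 : Euc m) 1, u y * fderiv ℝ φ y (EuclideanSpace.single i 1) := by
    rw [← integral_neg, ← integral_indicator measurableSet_ball]
    refine integral_congr_ae (Filter.Eventually.of_forall fun y => ?_)
    by_cases hy : y ∈ ball (0 : Euc m) 1
    · simp only [indicator_of_mem hy, hφd]; ring
    · simp only [indicator_of_notMem hy, zero_mul]
  rw [e1, hw, neg_neg, mollify, ← integral_sub_left_eq_self _ volume z,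
    ← integral_indicator measurableSet_ball]
  refine integral_congr_ae (Filter.Eventually.of_forall fun y => ?_)
  by_cases hy : y ∈ ball (0 : Euc m) 1
  · simp only [← hz, sub_sub_cancel, indicator_of_mem hy, φ, mul_comm]
  · simp only [← hz, sub_sub_cancel, indicator_of_notMem hy, mul_zero]

open Filter in
/-- Density of smooth functions in the Sobolev space of the ball. -/
lemma exists_smooth_approx {m : ℕ} {p : ENNReal} (hp : 1 ≤ p) (hp' : p ≠ ⊤) {u : Euc m → ℝ}
    {v : Fin m → Euc m → ℝ} (hu : MemLp u p (volume.restrict (ball (0 : Euc m) 1)))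
    (hv : ∀ i, MemLp (v i) p (volume.restrict (ball (0 : Euc m) 1)))
    (h : ∀ i, IsWeakPartialDeriv m (ball (0 : Euc m) 1) u i (v i)) :
    ∃ a : ℕ → Euc m → ℝ, (∀ k, ContDiff ℝ (⊤ : ℕ∞) (a k)) ∧
      Tendsto (fun k => eLpNorm (fun x => a k x - u x) p
        (volume.restrict (ball (0 : Euc m) 1))) atTop (nhds 0) ∧
      ∀ i, Tendsto (fun k => eLpNorm (fun x => fderiv ℝ (a k) x (EuclideanSpace.single i 1) - v i x)
        p (volume.restrict (ball (0 : Euc m) 1))) atTop (nhds 0) := by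
  set B := ball (0 : Euc m) 1 with hB
  have hfin : IsFiniteMeasure (volume.restrict B) := ⟨by simpa using measure_ball_lt_top⟩
  have hui : IntegrableOn u B := hu.integrable hp
  have hvi : ∀ i, IntegrableOn (v i) B := fun i => (hv i).integrable hp
  have hind : ∀ {w : Euc m → ℝ}, MemLp w p (volume.restrict B) → MemLp (B.indicator w) p volume :=
    fun hw => (memLp_indicator_iff_restrict measurableSet_ball).2 hw
  refine ⟨fun k => mollify m k (B.indicator u), fun k => contDiff_mollify k
    (hui.integrable_indicator measurableSet_ball).locallyIntegrable, ?_, fun i => ?_⟩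
  · refine (tendsto_mollify hp hp' (hind hu)).congr fun k => eLpNorm_congr_ae ?_
    filter_upwards [ae_restrict_mem measurableSet_ball] with x hx
    rw [indicator_of_mem hx]
  · have hlim : Tendsto (fun k => eLpNorm (fun x => mollify m k (B.indicator (v i)) x
        - B.indicator (v i) x) p (volume.restrict B)
        + ENNReal.ofReal |dilation k - 1| * eLpNorm (v i) p (volume.restrict B))
        atTop (nhds 0) := by
      have h1 : Tendsto (fun k => ENNReal.ofReal |dilation k - 1|) atTop (nhds 0) := by
        have : Tendsto (fun k => |dilation k - 1|) atTop (nhds 0) := by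
          simpa using (tendsto_dilation.sub_const 1).abs
        rw [← ENNReal.ofReal_zero]
        exact (ENNReal.continuous_ofReal.tendsto 0).comp this
      have h2 := ENNReal.Tendsto.mul_const (b := eLpNorm (v i) p (volume.restrict B)) h1
        (Or.inr (hv i).2.ne)
      simpa using (tendsto_mollify hp hp' (hind (hv i))).add h2
    refine tendsto_of_tendsto_of_tendsto_of_le_of_le tendsto_const_nhds hlim
      (fun _ => zero_le) fun k => ?_
    have hm1 : AEStronglyMeasurable (fun x => mollify m k (B.indicator (v i)) x
        - B.indicator (v i) x) (volume.restrict B) :=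
      (contDiff_mollify k ((hvi i).integrable_indicator measurableSet_ball).locallyIntegrable).continuous.aestronglyMeasurable.sub
        (hind (hv i)).1.restrict
    have e : (fun x => fderiv ℝ (mollify m k (B.indicator u)) x (EuclideanSpace.single i 1) - v i x)
        =ᵐ[volume.restrict B] (dilation k • fun x => mollify m k (B.indicator (v i)) x
          - B.indicator (v i) x) + (dilation k - 1) • v i := by
      filter_upwards [ae_restrict_mem measurableSet_ball] with x hx
      rw [fderiv_mollify_indicator k hui (h i) hx]
      simp only [Pi.add_apply, Pi.smul_apply, smul_eq_mul, indicator_of_mem hx]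
      ring
    refine (le_of_eq (eLpNorm_congr_ae e)).trans ((eLpNorm_add_le (hm1.const_smul _)
      ((hv i).1.const_smul _) hp).trans ?_)
    rw [eLpNorm_const_smul, eLpNorm_const_smul, ← ofReal_norm, ← ofReal_norm,
      Real.norm_eq_abs, Real.norm_eq_abs, abs_of_pos (dilation_pos k)]
    gcongr
    have : ENNReal.ofReal (dilation k) ≤ 1 := by
      rw [← ENNReal.ofReal_one]
      refine ENNReal.ofReal_le_ofReal ?_
      unfold dilation
      have : (0 : ℝ) ≤ 2 / ((k : ℝ) + 3) := by positivity
      linarith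
    simpa using mul_le_mul_left this (eLpNorm (fun x => mollify m k (B.indicator (v i)) x
        - B.indicator (v i) x) p (volume.restrict B))

open Filter in
/-- Dominated convergence in `L^p`. -/
lemma tendsto_eLpNorm_zero_of_dominated {α : Type*} [MeasurableSpace α] {μ : Measure α}
    {p : ENNReal} (hp : 1 ≤ p) (hp' : p ≠ ⊤) {F : ℕ → α → ℝ} {g : α → ℝ} (hg : MemLp g p μ)
    (hF : ∀ k, AEStronglyMeasurable (F k) μ) (hbd : ∀ k, ∀ᵐ x ∂μ, ‖F k x‖ ≤ ‖g x‖)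
    (hlim : ∀ᵐ x ∂μ, Tendsto (fun k => F k x) atTop (nhds 0)) :
    Tendsto (fun k => eLpNorm (F k) p μ) atTop (nhds 0) := by
  have hp0 : p ≠ 0 := (zero_lt_one.trans_le hp).ne'
  have hpr : 0 < p.toReal := ENNReal.toReal_pos hp0 hp'
  have key : Tendsto (fun k => ∫⁻ x, ‖F k x‖ₑ ^ p.toReal ∂μ) atTop (nhds (∫⁻ _, 0 ∂μ)) := by
    refine tendsto_lintegral_of_dominated_convergence' (fun x => ‖g x‖ₑ ^ p.toReal)
      (fun k => (hF k).enorm.pow_const _) (fun k => ?_) ?_ ?_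
    · filter_upwards [hbd k] with x hx
      exact ENNReal.rpow_le_rpow (enorm_le_iff_norm_le.2 hx) hpr.le
    · exact (lintegral_rpow_enorm_lt_top_of_eLpNorm_lt_top hp0 hp' hg.2).ne
    · filter_upwards [hlim] with x hx
      have h1 : Tendsto (fun k => ‖F k x‖ₑ) atTop (nhds 0) := by
        rw [← enorm_zero (E := ℝ)]
        exact (continuous_enorm.tendsto (0 : ℝ)).comp hx
      have h2 := (ENNReal.continuous_rpow_const (y := p.toReal)).tendsto 0 |>.comp h1
      rw [ENNReal.zero_rpow_of_pos hpr] at h2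
      exact h2
  simp only [lintegral_zero] at key
  have h2 := (ENNReal.continuous_rpow_const (y := 1 / p.toReal)).tendsto 0 |>.comp key
  rw [ENNReal.zero_rpow_of_pos (by positivity)] at h2
  refine h2.congr fun k => ?_
  rw [eLpNorm_eq_lintegral_rpow_enorm_toReal hp0 hp']
  rfl

open Filter in
/-- The chain rule for Sobolev gradients with prescribed trace. -/
lemma IsGradientWithTrace.comp_smooth {n : ℕ} {φ φ' : ℝ → ℝ} (hφ : ContDiff ℝ (⊤ : ℕ∞) φ)
    (hφ' : ∀ s, HasDerivAt φ (φ' s) s) (hc : Continuous φ') (hb1 : ∀ s, |φ' s| ≤ 1)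
    {u b : Euc (n+1) → ℝ} {v : Fin (n+1) → Euc (n+1) → ℝ}
    (hu : MemLp u ((n+1 : ℕ) : ENNReal) (volume.restrict (ball (0 : Euc (n+1)) 1)))
    (hv : ∀ i, MemLp (v i) ((n+1 : ℕ) : ENNReal) (volume.restrict (ball (0 : Euc (n+1)) 1)))
    {a : ℕ → Euc (n+1) → ℝ} (ha : ∀ k, ContDiff ℝ (⊤ : ℕ∞) (a k))
    (hau : Tendsto (fun k => eLpNorm (fun x => a k x - u x) ((n+1 : ℕ) : ENNReal)
        (volume.restrict (ball (0 : Euc (n+1)) 1))) atTop (nhds 0))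
    (hav : ∀ i, Tendsto (fun k => eLpNorm
        (fun x => fderiv ℝ (a k) x (EuclideanSpace.single i 1) - v i x) ((n+1 : ℕ) : ENNReal)
        (volume.restrict (ball (0 : Euc (n+1)) 1))) atTop (nhds 0))
    (hab : Tendsto (fun k => eLpNorm (fun x => a k x - b x) ((n+1 : ℕ) : ENNReal)
      ((μH[(n : ℝ)]).restrict (sphere (0 : Euc (n+1)) 1))) atTop (nhds 0)) :
    IsGradientWithTrace n (fun i x => φ' (u x) * v i x) (fun x => φ (b x)) := by
  set B := ball (0 : Euc (n+1)) 1 with hB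
  set p : ENNReal := ((n+1 : ℕ) : ENNReal) with hp
  have h1 : 1 ≤ p := by simp [hp]
  have htop : p ≠ ⊤ := ENNReal.natCast_ne_top _
  have hp0 : p ≠ 0 := (zero_lt_one.trans_le h1).ne'
  have hmeas : ∀ k, AEStronglyMeasurable (a k) (volume.restrict B) := fun k =>
    (ha k).continuous.aestronglyMeasurable
  obtain ⟨ns, hns, hae⟩ := (tendstoInMeasure_of_tendsto_eLpNorm hp0 hmeas hu.1
    hau).exists_seq_tendsto_ae
  have hmono : Tendsto ns atTop atTop := hns.tendsto_atTop
  have hlip : ∀ s t, |φ s - φ t| ≤ |s - t| := by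
    intro s t
    have := Convex.norm_image_sub_le_of_norm_hasDerivWithin_le (f := φ) (f' := φ') (s := univ)
      (C := 1) (x := t) (y := s) (fun x _ => (hφ' x).hasDerivWithinAt) (fun x _ => hb1 x)
      convex_univ trivial trivial
    simpa using this
  have hprod : ∀ {w z : Euc (n+1) → ℝ}, AEStronglyMeasurable w (volume.restrict B) →
      AEStronglyMeasurable z (volume.restrict B) →
      AEStronglyMeasurable (fun x => φ' (w x) * z x) (volume.restrict B) := fun hw hz =>
    (hc.comp_aestronglyMeasurable hw).mul hz
  refine ⟨fun i => (hv i).of_le (hprod hu.1 (hv i).1) (Eventually.of_forall fun x => ?_),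
    fun k x => φ (a (ns k) x), fun k => hφ.comp (ha _), fun i => ?_, ?_⟩
  · rw [norm_mul]
    exact mul_le_of_le_one_left (norm_nonneg _) (hb1 _)
  · have hder : ∀ k x, fderiv ℝ (fun x => φ (a k x)) x (EuclideanSpace.single i 1)
        = φ' (a k x) * fderiv ℝ (a k) x (EuclideanSpace.single i 1) := by
      intro k x
      have := (hφ' (a k x)).comp_hasFDerivAt x ((ha k).differentiable (by simp) x).hasFDerivAt
      rw [HasFDerivAt.fderiv (f := fun x => φ (a k x)) this]
      simp
    have hdm : ∀ k, AEStronglyMeasurable (fun x => fderiv ℝ (a k) x (EuclideanSpace.single i 1))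
        (volume.restrict B) := fun k => (continuous_partialDeriv (ha k) _).aestronglyMeasurable
    have hdom : Tendsto (fun k => eLpNorm (fun x => (φ' (a (ns k) x) - φ' (u x)) * v i x) p
        (volume.restrict B)) atTop (nhds 0) := by
      refine tendsto_eLpNorm_zero_of_dominated h1 htop ((hv i).const_mul 2) (fun k => ?_)
        (fun k => Eventually.of_forall fun x => ?_) ?_
      · exact ((hc.comp_aestronglyMeasurable (hmeas _)).sub
          (hc.comp_aestronglyMeasurable hu.1)).mul (hv i).1
      · rw [norm_mul, norm_mul]
        refine mul_le_mul_of_nonneg_right ?_ (norm_nonneg _)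
        have := norm_sub_le (φ' (a (ns k) x)) (φ' (u x))
        have := hb1 (a (ns k) x)
        have := hb1 (u x)
        simp only [Real.norm_eq_abs] at *
        rw [abs_two]
        linarith
      · filter_upwards [hae] with x hx
        have := (((hc.tendsto (u x)).comp hx).sub_const (φ' (u x))).mul_const (v i x)
        simpa using this
    refine tendsto_of_tendsto_of_tendsto_of_le_of_le tendsto_const_nhds
      (by simpa using ((hav i).comp hmono).add hdom) (fun _ => zero_le) fun k => ?_
    have e : (fun x => fderiv ℝ (fun x => φ (a (ns k) x)) x (EuclideanSpace.single i 1)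
          - φ' (u x) * v i x)
        = (fun x => φ' (a (ns k) x) * (fderiv ℝ (a (ns k)) x (EuclideanSpace.single i 1) - v i x))
          + fun x => (φ' (a (ns k) x) - φ' (u x)) * v i x := by
      funext x
      rw [hder]
      simp only [Pi.add_apply]
      ring
    rw [e]
    refine (eLpNorm_add_le (hprod (hmeas _) ((hdm _).sub (hv i).1))
      (((hc.comp_aestronglyMeasurable (hmeas _)).sub
          (hc.comp_aestronglyMeasurable hu.1)).mul (hv i).1) h1).trans ?_
    refine add_le_add (eLpNorm_mono fun x => ?_) le_rfl
    rw [norm_mul]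
    exact mul_le_of_le_one_left (norm_nonneg _) (hb1 _)
  · refine tendsto_of_tendsto_of_tendsto_of_le_of_le tendsto_const_nhds
      (hab.comp hmono) (fun _ => zero_le) fun k => ?_
    exact eLpNorm_mono fun x => hlip _ _

/-- Contracting the contact form against the rows `w i • α i`. -/
lemma det_cons_add_sum_det {n : ℕ} (η : Fin (n+1) → ℝ) (α γ : Fin n → Fin (n+1) → ℝ)
    (f g w : Fin n → ℝ) :
    (Matrix.of (Fin.cons η fun i => w i • α i : Fin (n+1) → Fin (n+1) → ℝ)).det
      + 2 * ∑ j, (Matrix.of (Fin.cons (γ j) (Function.update (fun i => w i • α i) j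
          ((f j * w j) • α j)) : Fin (n+1) → Fin (n+1) → ℝ)).det
      = (Matrix.of (Fin.cons (η - ∑ j, ((2 * g j) • α j - (2 * f j) • γ j))
          fun i => w i • α i : Fin (n+1) → Fin (n+1) → ℝ)).det := by
  let R : Fin n → Fin (n+1) → ℝ := fun i => w i • α i
  let L : (Fin (n+1) → ℝ) →ₗ[ℝ] ℝ := (Matrix.detRowAlternating :
    (Fin (n+1) → ℝ) [⋀^Fin (n+1)]→ₗ[ℝ] ℝ).toMultilinearMap.toLinearMap (Fin.cons 0 R) 0
  have hL : ∀ u, (Matrix.of (Fin.cons u R : Fin (n+1) → Fin (n+1) → ℝ)).det = L u := by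
    intro u
    have : (Fin.cons u R : Fin (n+1) → Fin (n+1) → ℝ) = Function.update (Fin.cons 0 R) 0 u := by
      simp
    rw [this]
    rfl
  have hupd : ∀ (u : Fin (n+1) → ℝ) (j : Fin n) (z : Fin (n+1) → ℝ),
      (Matrix.of (Fin.cons u (Function.update R j z) : Fin (n+1) → Fin (n+1) → ℝ))
        = (Matrix.of (Fin.cons u R : Fin (n+1) → Fin (n+1) → ℝ)).updateRow j.succ z := by
    intro u j z
    ext r i
    refine Fin.cases ?_ (fun r => ?_) r
    · rw [Matrix.updateRow_ne (Fin.succ_ne_zero j).symm]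
      rfl
    · by_cases h : r = j
      · subst h; simp
      · rw [Matrix.updateRow_ne (by simpa using h)]
        simp only [Matrix.of_apply, Fin.cons_succ, Function.update_of_ne h]
  have hzero : ∀ j, L (α j) = 0 := by
    intro j
    have h1 : (Matrix.of (Fin.cons (α j) R : Fin (n+1) → Fin (n+1) → ℝ))
        = (Matrix.of (Fin.cons (α j) R : Fin (n+1) → Fin (n+1) → ℝ)).updateRow j.succ
          (w j • α j) := by
      rw [← hupd, show w j • α j = R j from rfl, Function.update_eq_self]
    rw [← hL, h1, Matrix.det_updateRow_smul]
    refine mul_eq_zero_of_right _ (Matrix.det_zero_of_row_eq (Fin.succ_ne_zero j) ?_)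
    rw [Matrix.updateRow_self, Matrix.updateRow_ne (Fin.succ_ne_zero j).symm]
    rfl
  have hγ : ∀ j, (Matrix.of (Fin.cons (γ j) (Function.update R j
      ((f j * w j) • α j)) : Fin (n+1) → Fin (n+1) → ℝ)).det = f j * L (γ j) := by
    intro j
    rw [hupd, mul_smul, Matrix.det_updateRow_smul, show w j • α j = R j from rfl, ← hupd,
      Function.update_eq_self, hL]
  change (Matrix.of (Fin.cons η R : Fin (n+1) → Fin (n+1) → ℝ)).det
      + 2 * ∑ j, (Matrix.of (Fin.cons (γ j) (Function.update R j
          ((f j * w j) • α j)) : Fin (n+1) → Fin (n+1) → ℝ)).det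
      = (Matrix.of (Fin.cons (η - ∑ j, ((2 * g j) • α j - (2 * f j) • γ j))
          R : Fin (n+1) → Fin (n+1) → ℝ)).det
  simp only [hγ, hL, map_sub, map_sum, map_smul, hzero, smul_eq_mul, mul_zero, zero_sub,
    Finset.sum_neg_distrib, sub_neg_eq_add, Finset.mul_sum, mul_assoc]

lemma det_cons_smul_single {n : ℕ} (c : ℝ) (w : Fin n → ℝ) :
    (Matrix.of (Fin.cons (c • Pi.single 0 1) fun i => w i • Pi.single i.succ 1 :
      Fin (n+1) → Fin (n+1) → ℝ)).det = c * ∏ i, w i := by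
  have : (Matrix.of (Fin.cons (c • Pi.single 0 1) fun i => w i • Pi.single i.succ 1 :
      Fin (n+1) → Fin (n+1) → ℝ)) = Matrix.diagonal (Fin.cons c w : Fin (n+1) → ℝ) := by
    ext r i
    refine Fin.cases ?_ (fun r => ?_) r <;>
      simp [Matrix.diagonal_apply, Pi.single_apply, eq_comm]
  rw [this, Matrix.det_diagonal, Fin.prod_univ_succ]
  simp

/-- The vector of partial derivatives. -/
def partials {m : ℕ} (b : Euc m → ℝ) (x : Euc m) : Fin m → ℝ :=
  fun i => fderiv ℝ b x (EuclideanSpace.single i 1)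

lemma jac_cons {n : ℕ} (b : Euc (n+1) → ℝ) (R : Fin n → Euc (n+1) → ℝ) (x : Euc (n+1)) :
    jac (Fin.cons b R : Fin (n+1) → Euc (n+1) → ℝ) x
      = Matrix.of (Fin.cons (partials b x) fun j => partials (R j) x :
        Fin (n+1) → Fin (n+1) → ℝ) := by
  ext r i
  refine Fin.cases ?_ (fun r => ?_) r <;> rfl

lemma hasFDerivAt_euc_apply {m : ℕ} (k : Fin m) (x : Euc m) :
    HasFDerivAt (fun x : Euc m => x k) (EuclideanSpace.proj k : Euc m →L[ℝ] ℝ) x :=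
  (EuclideanSpace.proj k : Euc m →L[ℝ] ℝ).hasFDerivAt

lemma partials_comp {m : ℕ} {φ : ℝ → ℝ} {d : ℝ} (k : Fin m) (x : Euc m)
    (h : HasDerivAt φ d (x k)) :
    partials (fun x : Euc m => φ (x k)) x = d • Pi.single k 1 := by
  funext i
  have := h.comp_hasFDerivAt x (hasFDerivAt_euc_apply k x)
  rw [partials, HasFDerivAt.fderiv (f := fun x : Euc m => φ (x k)) this]
  simp [Pi.single_apply, eq_comm]

lemma partials_mul {m : ℕ} (k l : Fin m) (x : Euc m) :
    partials (fun x : Euc m => x k * x l) x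
      = x l • Pi.single k 1 + x k • Pi.single l 1 := by
  funext i
  have := (hasFDerivAt_euc_apply k x).mul (hasFDerivAt_euc_apply l x)
  rw [partials, HasFDerivAt.fderiv (f := fun x : Euc m => x k * x l) this]
  simp [Pi.single_apply, eq_comm, add_comm]

/-- An antiderivative of `s / (1 + s ^ 2)`. -/
def halfLog (s : ℝ) : ℝ := 1 / 2 * Real.log (1 + s ^ 2)

lemma hasDerivAt_halfLog (s : ℝ) : HasDerivAt halfLog (s * (1 / (1 + s ^ 2))) s := by
  have h0 : 1 + s ^ 2 ≠ 0 := by positivity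
  have h1 : HasDerivAt (fun s : ℝ => 1 + s ^ 2) (2 * s) s := by
    simpa using (hasDerivAt_pow 2 s).const_add 1
  convert! (h1.log h0).const_mul (1 / 2) using 1
  field_simp

lemma contDiff_halfLog : ContDiff ℝ (⊤ : ℕ∞) halfLog :=
  contDiff_const.mul ((contDiff_const.add (contDiff_id.pow 2)).log fun s => by positivity)

lemma abs_inv_one_add_sq_le (s : ℝ) : |1 / (1 + s ^ 2)| ≤ 1 := by
  rw [abs_of_nonneg (by positivity)]
  exact div_le_one_of_le₀ (by nlinarith [sq_nonneg s]) (by positivity)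

lemma abs_mul_inv_one_add_sq_le (s : ℝ) : |s * (1 / (1 + s ^ 2))| ≤ 1 := by
  rw [mul_one_div, abs_div, abs_of_pos (by positivity : 0 < 1 + s ^ 2)]
  refine div_le_one_of_le₀ ?_ (by positivity)
  rw [← sq_abs]
  nlinarith [sq_nonneg (|s| - 1), abs_nonneg s]

lemma continuous_inv_one_add_sq : Continuous fun s : ℝ => 1 / (1 + s ^ 2) :=
  continuous_const.div (by fun_prop) fun s => by positivity

lemma contDiff_apply_euc {m : ℕ} (k : Fin m) :
    ContDiff ℝ (⊤ : ℕ∞) fun x : Euc m => x k :=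
  (EuclideanSpace.proj k : Euc m →L[ℝ] ℝ).contDiff

lemma sum_sq_eq_norm_sq {n : ℕ} (x : Euc (n+1)) :
    x 0 ^ 2 + ∑ j : Fin n, x j.succ ^ 2 = ‖x‖ ^ 2 := by
  rw [EuclideanSpace.norm_sq_eq, Fin.sum_univ_succ]
  simp

/-- There is no horizontal Sobolev map on the ball with the traces of the Whitney sphere. -/
lemma false_of_contact_of_trace {n : ℕ} {F : Euc (n+1) → Euc (2*n+1)}
    {v : Fin (2*n+1) → Fin (n+1) → Euc (n+1) → ℝ}
    (hcontact : ContactAEOn (n+1) n (ball (0 : Euc (n+1)) 1) F v)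
    (hX : ∀ j, IsGradientWithTrace n (fun i x => 1 / (1 + F x (xIdx n j) ^ 2) * v (xIdx n j) i x)
      (fun x => Real.arctan (x j.succ)))
    (hX' : ∀ j, IsGradientWithTrace n
      (fun i x => F x (xIdx n j) * (1 / (1 + F x (xIdx n j) ^ 2)) * v (xIdx n j) i x)
      (fun x => halfLog (x j.succ)))
    (hY : ∀ j, IsGradientWithTrace n (v (yIdx n j)) (fun x => x 0 * x j.succ))
    (hT : IsGradientWithTrace n (v (tIdx n)) (fun x => -2 * (x 0 - x 0 ^ 3 / 3))) : False := by
  let φ : ℝ → ℝ := fun s => -2 * (s - s ^ 3 / 3)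
  have hφ : ∀ s, HasDerivAt φ (-2 * (1 - s ^ 2)) s := by
    intro s
    convert! ((hasDerivAt_id s).sub ((hasDerivAt_pow 3 s).div_const 3)).const_mul (-2) using 1
    ring
  let A : Fin n → Fin (n+1) → Euc (n+1) → ℝ :=
    fun j i x => 1 / (1 + F x (xIdx n j) ^ 2) * v (xIdx n j) i x
  let A' : Fin n → Fin (n+1) → Euc (n+1) → ℝ :=
    fun j i x => F x (xIdx n j) * (1 / (1 + F x (xIdx n j) ^ 2)) * v (xIdx n j) i x
  let b : Fin n → Euc (n+1) → ℝ := fun j x => Real.arctan (x j.succ)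
  let b' : Fin n → Euc (n+1) → ℝ := fun j x => halfLog (x j.succ)
  let M₀ : Fin (n+1) → Fin (n+1) → Euc (n+1) → ℝ := Fin.cons (v (tIdx n)) A
  let M : Fin n → Fin (n+1) → Fin (n+1) → Euc (n+1) → ℝ :=
    fun j => Fin.cons (v (yIdx n j)) (Function.update A j (A' j))
  let B₀ : Fin (n+1) → Euc (n+1) → ℝ := Fin.cons (fun x => φ (x 0)) b
  let B : Fin n → Fin (n+1) → Euc (n+1) → ℝ :=
    fun j => Fin.cons (fun x => x 0 * x j.succ) (Function.update b j (b' j))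
  have hb : ∀ j, ContDiff ℝ (⊤ : ℕ∞) (b j) := fun j =>
    Real.contDiff_arctan.comp (contDiff_apply_euc j.succ)
  have hb' : ∀ j, ContDiff ℝ (⊤ : ℕ∞) (b' j) := fun j =>
    contDiff_halfLog.comp (contDiff_apply_euc j.succ)
  have hM₀ : ∀ r, IsGradientWithTrace n (M₀ r) (B₀ r) := by
    intro r
    refine Fin.cases hT (fun r => hX r) r
  have hM : ∀ j r, IsGradientWithTrace n (M j r) (B j r) := by
    intro j r
    refine Fin.cases (hY j) (fun r => ?_) r
    simp only [M, B, Fin.cons_succ]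
    by_cases h : r = j
    · subst h; rw [Function.update_self, Function.update_self]; exact hX' r
    · rw [Function.update_of_ne h, Function.update_of_ne h]; exact hX r
  have hB₀ : ∀ r, ContDiff ℝ (⊤ : ℕ∞) (B₀ r) := by
    intro r
    refine Fin.cases ?_ (fun r => hb r) r
    have h0 := contDiff_apply_euc (0 : Fin (n+1))
    exact contDiff_const.mul (h0.sub ((h0.pow 3).div_const 3))
  have hB : ∀ j r, ContDiff ℝ (⊤ : ℕ∞) (B j r) := by
    intro j r
    refine Fin.cases ((contDiff_apply_euc _).mul (contDiff_apply_euc _)) (fun r => ?_) r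
    simp only [B, Fin.cons_succ]
    by_cases h : r = j
    · subst h; simpa using hb' r
    · simpa [Function.update_of_ne h] using hb r
  have hI₀ := integrable_det_of_memLp n.succ_ne_zero
    (M := fun x => Matrix.of fun r i => M₀ r i x) fun r i => (hM₀ r).1 i
  have hI := fun j => integrable_det_of_memLp n.succ_ne_zero
    (M := fun x => Matrix.of fun r i => M j r i x) fun r i => (hM j r).1 i
  have hJ : ∀ {c : Fin (n+1) → Euc (n+1) → ℝ}, (∀ r, ContDiff ℝ (⊤ : ℕ∞) (c r)) →
      IntegrableOn (fun x => (jac c x).det) (ball (0 : Euc (n+1)) 1) := fun hc =>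
    integrable_det_of_memLp n.succ_ne_zero fun r i =>
      memLp_ball_of_continuous (continuous_partialDeriv (hc r) _) _
  have hleft : ∫ x in ball (0 : Euc (n+1)) 1, ((Matrix.of fun r i => M₀ r i x).det
      + 2 * ∑ j, (Matrix.of fun r i => M j r i x).det) = 0 := by
    refine integral_eq_zero_of_ae ?_
    filter_upwards [hcontact] with x hx
    have := det_cons_add_sum_det (fun i => v (tIdx n) i x) (fun j i => v (xIdx n j) i x)
      (fun j i => v (yIdx n j) i x) (fun j => F x (xIdx n j)) (fun j => F x (yIdx n j))
      (fun j => 1 / (1 + F x (xIdx n j) ^ 2))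
    have e0 : (Matrix.of fun r i => M₀ r i x) = Matrix.of (Fin.cons (fun i => v (tIdx n) i x)
        fun j => (1 / (1 + F x (xIdx n j) ^ 2)) • fun i => v (xIdx n j) i x :
          Fin (n+1) → Fin (n+1) → ℝ) := by
      ext r i
      refine Fin.cases ?_ (fun r => ?_) r <;> rfl
    have e1 : ∀ j, (Matrix.of fun r i => M j r i x) = Matrix.of (Fin.cons
        (fun i => v (yIdx n j) i x) (Function.update
          (fun j => (1 / (1 + F x (xIdx n j) ^ 2)) • fun i => v (xIdx n j) i x) j
          ((F x (xIdx n j) * (1 / (1 + F x (xIdx n j) ^ 2))) • fun i => v (xIdx n j) i x)) :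
          Fin (n+1) → Fin (n+1) → ℝ) := by
      intro j
      ext r i
      refine Fin.cases rfl (fun r => ?_) r
      by_cases h : r = j
      · subst h; simp only [M, Matrix.of_apply, Fin.cons_succ, Function.update_self]; rfl
      · simp only [M, Matrix.of_apply, Fin.cons_succ, Function.update_of_ne h]; rfl
    simp only [e0, e1, Pi.zero_apply]
    rw [this]
    refine Matrix.det_eq_zero_of_row_eq_zero 0 fun i => ?_
    simp only [Matrix.of_apply, Fin.cons_zero, Pi.sub_apply, Finset.sum_apply, Pi.smul_apply,
      smul_eq_mul, hx i, Finset.mul_sum]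
    rw [← Finset.sum_sub_distrib]
    exact Finset.sum_eq_zero fun j _ => by ring
  have hright : ∀ x, (jac B₀ x).det + 2 * ∑ j, (jac (B j) x).det
      = -2 * (1 - ‖x‖ ^ 2) * ∏ j : Fin n, (1 / (1 + x j.succ ^ 2)) := by
    intro x
    have hpb : ∀ j, partials (b j) x = (1 / (1 + x j.succ ^ 2)) • Pi.single j.succ 1 := fun j =>
      partials_comp j.succ x (Real.hasDerivAt_arctan _)
    have hpb' : ∀ j, partials (b' j) x
        = (x j.succ * (1 / (1 + x j.succ ^ 2))) • Pi.single j.succ 1 := fun j =>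
      partials_comp j.succ x (hasDerivAt_halfLog _)
    have := det_cons_add_sum_det ((-2 * (1 - x 0 ^ 2)) • Pi.single 0 1)
      (fun j : Fin n => Pi.single j.succ 1)
      (fun j => x j.succ • Pi.single 0 1 + x 0 • Pi.single j.succ 1)
      (fun j => x j.succ) (fun j => x 0 * x j.succ) (fun j => 1 / (1 + x j.succ ^ 2))
    have e0 : jac B₀ x = _ := jac_cons _ _ x
    have e1 : ∀ j, jac (B j) x = Matrix.of (Fin.cons
        (x j.succ • Pi.single 0 1 + x 0 • Pi.single j.succ 1)
        (Function.update (fun j => (1 / (1 + x j.succ ^ 2)) • Pi.single j.succ 1) j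
          ((x j.succ * (1 / (1 + x j.succ ^ 2))) • Pi.single j.succ 1)) :
          Fin (n+1) → Fin (n+1) → ℝ) := by
      intro j
      have : jac (B j) x = _ := jac_cons _ _ x
      rw [this, partials_mul]
      congr 2
      funext r
      by_cases h : r = j
      · subst h; simp only [Function.update_self, hpb']
      · simp only [Function.update_of_ne h, hpb]
    rw [e0, partials_comp 0 x (hφ _)]
    simp only [hpb, e1]
    rw [this, ← det_cons_smul_single]
    congr 4
    rw [← sum_sq_eq_norm_sq]
    have e2 : ∀ j : Fin n, (2 * (x 0 * x j.succ)) • (Pi.single j.succ 1 : Fin (n+1) → ℝ)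
        - (2 * x j.succ) • (x j.succ • Pi.single 0 1 + x 0 • Pi.single j.succ 1)
        = (-2 * x j.succ ^ 2) • Pi.single 0 1 := by
      intro j
      module
    simp only [e2]
    rw [← Finset.sum_smul, ← Finset.mul_sum, ← sub_smul]
    congr 1
    ring
  have hzero : ∫ x in ball (0 : Euc (n+1)) 1,
      -2 * (1 - ‖x‖ ^ 2) * ∏ j : Fin n, (1 / (1 + x j.succ ^ 2)) = 0 := by
    rw [← hleft]
    simp only [← hright]
    rw [integral_add (hJ hB₀) ((integrable_finsetSum _ fun j _ => hJ (hB j)).const_mul 2),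
      integral_add hI₀ ((integrable_finsetSum _ fun j _ => hI j).const_mul 2),
      integral_const_mul, integral_const_mul, integral_finsetSum _ (fun j _ => hJ (hB j)),
      integral_finsetSum _ (fun j _ => hI j), integral_det_eq_integral_det_jac hM₀ hB₀]
    congr 2
    exact Finset.sum_congr rfl fun j _ => (integral_det_eq_integral_det_jac (hM j) (hB j)).symm
  have hpos : ∀ x ∈ ball (0 : Euc (n+1)) 1,
      0 < 2 * (1 - ‖x‖ ^ 2) * ∏ j : Fin n, (1 / (1 + x j.succ ^ 2)) := by
    intro x hx
    have h1 := mem_ball_zero_iff.1 hx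
    have h2 : ‖x‖ ^ 2 < 1 := by nlinarith [norm_nonneg x]
    have h3 : 0 < ∏ j : Fin n, (1 / (1 + x j.succ ^ 2)) :=
      Finset.prod_pos fun j _ => by positivity
    have : 0 < 1 - ‖x‖ ^ 2 := by linarith
    positivity
  have hcont : Continuous fun x : Euc (n+1) =>
      2 * (1 - ‖x‖ ^ 2) * ∏ j : Fin n, (1 / (1 + x j.succ ^ 2)) := by
    refine (by fun_prop : Continuous fun x : Euc (n+1) => 2 * (1 - ‖x‖ ^ 2)).mul
      (continuous_finsetProd _ fun j _ => ?_)
    exact continuous_inv_one_add_sq.comp (contDiff_apply_euc j.succ).continuous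
  have hint : IntegrableOn (fun x : Euc (n+1) =>
      2 * (1 - ‖x‖ ^ 2) * ∏ j : Fin n, (1 / (1 + x j.succ ^ 2))) (ball (0 : Euc (n+1)) 1) :=
    memLp_one_iff_integrable.1 (memLp_ball_of_continuous hcont 1)
  have hfinal : 0 < ∫ x in ball (0 : Euc (n+1)) 1,
      2 * (1 - ‖x‖ ^ 2) * ∏ j : Fin n, (1 / (1 + x j.succ ^ 2)) := by
    rw [setIntegral_pos_iff_support_of_nonneg_ae _ hint]
    · refine (measure_ball_pos volume (0 : Euc (n+1)) one_pos).trans_le (measure_mono fun x hx => ?_)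
      exact ⟨(hpos x hx).ne', hx⟩
    · filter_upwards [ae_restrict_mem measurableSet_ball] with x hx
      exact (hpos x hx).le
  have e3 : ∀ x : Euc (n+1), -2 * (1 - ‖x‖ ^ 2) * ∏ j : Fin n, (1 / (1 + x j.succ ^ 2))
      = -(2 * (1 - ‖x‖ ^ 2) * ∏ j : Fin n, (1 / (1 + x j.succ ^ 2))) := fun x => by ring
  simp only [e3] at hzero
  rw [integral_neg] at hzero
  linarith

lemma fin_heis_cases {n : ℕ} {P : Fin (2*n+1) → Prop} (hx : ∀ j, P (xIdx n j))
    (hy : ∀ j, P (yIdx n j)) (ht : P (tIdx n)) (i : Fin (2*n+1)) : P i := by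
  obtain ⟨i, hi⟩ := i
  rcases Nat.lt_or_ge i (2*n) with h | h
  · rcases Nat.mod_two_eq_zero_or_one i with h' | h'
    · have := hx ⟨i/2, by omega⟩
      simpa only [xIdx, show 2 * (i/2) = i by omega] using this
    · have := hy ⟨i/2, by omega⟩
      simpa only [yIdx, show 2 * (i/2) + 1 = i by omega] using this
  · have : i = 2*n := by omega
    subst this
    exact ht

/-- The vector of `ℝ^{2n+1}` with the prescribed `x`, `y` and `t` coordinates. -/
def heisVec (n : ℕ) (p q : Fin n → ℝ) (r : ℝ) : Euc (2*n+1) :=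
  WithLp.toLp 2 fun i =>
    if h : i.val < 2*n then
      if i.val % 2 = 0 then p ⟨i.val/2, by omega⟩ else q ⟨i.val/2, by omega⟩
    else r

lemma heisVec_xIdx {n : ℕ} (p q : Fin n → ℝ) (r : ℝ) (j : Fin n) :
    heisVec n p q r (xIdx n j) = p j := by
  simp [heisVec, xIdx]

lemma heisVec_yIdx {n : ℕ} (p q : Fin n → ℝ) (r : ℝ) (j : Fin n) :
    heisVec n p q r (yIdx n j) = q j := by
  have h1 : 2 * (j : ℕ) + 1 < 2 * n := by omega
  have h2 : (2 * (j : ℕ) + 1) / 2 = j := by omega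
  simp [heisVec, yIdx, h1, h2]

lemma heisVec_tIdx {n : ℕ} (p q : Fin n → ℝ) (r : ℝ) : heisVec n p q r (tIdx n) = r := by
  simp [heisVec, tIdx]

/-- The Legendrian lift to `ℍⁿ` of the Whitney sphere. -/
def whitney (n : ℕ) (x : Euc (n+1)) : Euc (2*n+1) :=
  heisVec n (fun j => x j.succ) (fun j => x 0 * x j.succ) (-2 * (x 0 - x 0 ^ 3 / 3))

/-- The differential of `whitney` at `x` applied to `w`. -/
def whitneyDiff (n : ℕ) (x w : Euc (n+1)) : Euc (2*n+1) :=
  heisVec n (fun j => w j.succ) (fun j => w 0 * x j.succ + x 0 * w j.succ)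
    (-2 * (1 - x 0 ^ 2) * w 0)

lemma whitneyDiff_contact {n : ℕ} {x : Euc (n+1)} (hx : ‖x‖ = 1) (w : Euc (n+1)) :
    whitneyDiff n x w (tIdx n) = 2 * ∑ j : Fin n,
      (whitney n x (yIdx n j) * whitneyDiff n x w (xIdx n j)
        - whitney n x (xIdx n j) * whitneyDiff n x w (yIdx n j)) := by
  have h := sum_sq_eq_norm_sq x
  rw [hx] at h
  have h1 : 1 - x 0 ^ 2 = ∑ j : Fin n, x j.succ ^ 2 := by linarith
  simp only [whitney, whitneyDiff, heisVec_xIdx, heisVec_yIdx, heisVec_tIdx]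
  rw [h1, mul_assoc, Finset.sum_mul, Finset.mul_sum, Finset.mul_sum]
  exact Finset.sum_congr rfl fun j _ => by ring

lemma hasDerivAt_euc_apply {m : ℕ} {σ : ℝ → Euc m} {w : Euc m} {s : ℝ}
    (h : HasDerivAt σ w s) (i : Fin m) : HasDerivAt (fun s => σ s i) (w i) s :=
  (hasFDerivAt_euc_apply i (σ s)).comp_hasDerivAt s h

lemma hasDerivAt_whitney {n : ℕ} {σ : ℝ → Euc (n+1)} {w : Euc (n+1)} {s : ℝ}
    (h : HasDerivAt σ w s) (i : Fin (2*n+1)) :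
    HasDerivAt (fun s => whitney n (σ s) i) (whitneyDiff n (σ s) w i) s := by
  have h0 := hasDerivAt_euc_apply h 0
  revert i
  refine fin_heis_cases (fun j => ?_) (fun j => ?_) ?_ <;>
    simp only [whitney, whitneyDiff, heisVec_xIdx, heisVec_yIdx, heisVec_tIdx]
  · exact hasDerivAt_euc_apply h _
  · exact h0.mul (hasDerivAt_euc_apply h _)
  · convert! (h0.sub ((h0.pow 3).div_const 3)).const_mul (-2) using 1
    push_cast
    ring

lemma continuous_whitneyDiff_apply {n : ℕ} {σ τ : ℝ → Euc (n+1)} (hσ : Continuous σ)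
    (hτ : Continuous τ) (i : Fin (2*n+1)) :
    Continuous fun s => whitneyDiff n (σ s) (τ s) i := by
  revert i
  refine fin_heis_cases (fun j => ?_) (fun j => ?_) ?_ <;>
    simp only [whitneyDiff, heisVec_xIdx, heisVec_yIdx, heisVec_tIdx] <;> fun_prop

lemma ccDist_le {n : ℕ} {a b : ℝ} {γ g : ℝ → Euc (2*n+1)} (hab : a ≤ b)
    (h : IsHorizontalWith n a b γ g) : ccDist n (γ a) (γ b) ≤ horizLength n a b g := by
  refine csInf_le ⟨0, ?_⟩ ⟨a, b, γ, g, hab, h, rfl, rfl, rfl⟩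
  rintro _ ⟨a, b, γ, g, hab, -, -, -, rfl⟩
  exact intervalIntegral.integral_nonneg hab fun s _ => Real.sqrt_nonneg _

lemma whitneyDiff_horiz_le {n : ℕ} {x w : Euc (n+1)} (hx : ‖x‖ = 1) (hw : ‖w‖ = 1) :
    ∑ j : Fin n, (whitneyDiff n x w (xIdx n j) ^ 2 + whitneyDiff n x w (yIdx n j) ^ 2)
      ≤ 5 * n := by
  have key : ∀ {z : Euc (n+1)}, ‖z‖ = 1 → ∀ i, |z i| ≤ 1 := fun {z} hz i => by
    simpa [hz] using PiLp.norm_apply_le z i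
  have : ∀ j ∈ Finset.univ (α := Fin n),
      whitneyDiff n x w (xIdx n j) ^ 2 + whitneyDiff n x w (yIdx n j) ^ 2 ≤ 5 := by
    intro j _
    simp only [whitneyDiff, heisVec_xIdx, heisVec_yIdx]
    have h1 : |w j.succ| ≤ 1 := key hw _
    have h2 : |w 0 * x j.succ + x 0 * w j.succ| ≤ 1 + 1 := by
      refine (abs_add_le _ _).trans (add_le_add ?_ ?_) <;> rw [abs_mul]
      · exact mul_le_one₀ (key hw _) (abs_nonneg _) (key hx _)
      · exact mul_le_one₀ (key hx _) (abs_nonneg _) (key hw _)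
    have h3 := sq_le_sq' (neg_le_of_abs_le h1) (le_of_abs_le h1)
    have h4 := sq_le_sq' (neg_le_of_abs_le h2) (le_of_abs_le h2)
    linarith
  refine (Finset.sum_le_sum this).trans ?_
  simp [mul_comm]

lemma norm_cos_smul_add_sin_smul {m : ℕ} {x e : Euc m} (hx : ‖x‖ = 1) (he : ‖e‖ = 1)
    (hxe : inner ℝ x e = 0) (s : ℝ) : ‖Real.cos s • x + Real.sin s • e‖ = 1 := by
  have h := norm_add_sq_real (Real.cos s • x) (Real.sin s • e)
  rw [real_inner_smul_left, real_inner_smul_right, hxe, norm_smul, norm_smul, hx, he,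
    Real.norm_eq_abs, Real.norm_eq_abs, mul_one, mul_one, sq_abs, sq_abs] at h
  refine (pow_eq_one_iff_of_nonneg (norm_nonneg _) two_ne_zero).1 (h.trans ?_)
  linarith [Real.cos_sq_add_sin_sq s]

/-- Any point of the unit sphere lies on a great half circle starting at a given point. -/
lemma exists_great_circle {n : ℕ} (hn : 1 ≤ n) {x y : Euc (n+1)} (hx : ‖x‖ = 1) (hy : ‖y‖ = 1) :
    ∃ e : Euc (n+1), ∃ θ ∈ Icc 0 Real.pi, ‖e‖ = 1 ∧ inner ℝ x e = 0 ∧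
      y = Real.cos θ • x + Real.sin θ • e := by
  have hxx : inner ℝ x x = 1 := by rw [real_inner_self_eq_norm_sq, hx, one_pow]
  set c : ℝ := inner ℝ x y with hc
  have hc1 : |c| ≤ 1 := by simpa [hx, hy] using abs_real_inner_le_norm x y
  have hcos : Real.cos (Real.arccos c) = c :=
    Real.cos_arccos (neg_le_of_abs_le hc1) (le_of_abs_le hc1)
  set z : Euc (n+1) := y - c • x with hz
  have hxz : inner ℝ x z = 0 := by
    rw [hz, inner_sub_right, real_inner_smul_right, hxx, ← hc]; ring
  have hzn : ‖z‖ = Real.sin (Real.arccos c) := by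
    have h := norm_sub_sq_real y (c • x)
    rw [real_inner_smul_right, real_inner_comm, ← hc, norm_smul, hx, hy, Real.norm_eq_abs,
      mul_one, sq_abs] at h
    rw [Real.sin_arccos, ← Real.sqrt_sq (norm_nonneg z), h]
    congr 1
    ring
  have hyz : y = c • x + z := by rw [hz]; abel
  obtain ⟨e, he, hxe, hez⟩ : ∃ e : Euc (n+1), ‖e‖ = 1 ∧ inner ℝ x e = 0 ∧ z = ‖z‖ • e := by
    by_cases h0 : z = 0
    · have hne : (Submodule.span ℝ {x})ᗮ ≠ ⊥ := by
        intro h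
        rw [Submodule.orthogonal_eq_bot_iff] at h
        have h1 := finrank_span_singleton (K := ℝ) (v := x) (by rintro rfl; simp at hx)
        rw [h, finrank_top, finrank_euclideanSpace, Fintype.card_fin] at h1
        omega
      obtain ⟨u, hu, hu0⟩ := Submodule.exists_mem_ne_zero_of_ne_bot hne
      refine ⟨‖u‖⁻¹ • u, norm_smul_inv_norm (𝕜 := ℝ) hu0, ?_, by simp [h0]⟩
      rw [real_inner_smul_right, Submodule.mem_orthogonal_singleton_iff_inner_right.1 hu, mul_zero]
    · refine ⟨‖z‖⁻¹ • z, norm_smul_inv_norm (𝕜 := ℝ) h0, ?_, ?_⟩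
      · rw [real_inner_smul_right, hxz, mul_zero]
      · rw [smul_smul, mul_inv_cancel₀ (norm_ne_zero_iff.2 h0), one_smul]
  refine ⟨e, Real.arccos c, ⟨Real.arccos_nonneg c, Real.arccos_le_pi c⟩, he, hxe, ?_⟩
  rw [hcos, ← hzn, ← hez]
  exact hyz

lemma angle_le_mul_dist {m : ℕ} {x e : Euc m} (hx : ‖x‖ = 1) (he : ‖e‖ = 1)
    (hxe : inner ℝ x e = 0) {θ : ℝ} (hθ : θ ∈ Icc 0 Real.pi) :
    θ ≤ Real.pi / 2 * dist x (Real.cos θ • x + Real.sin θ • e) := by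
  have h1 : dist x (Real.cos θ • x + Real.sin θ • e) ^ 2 = (2 * Real.sin (θ / 2)) ^ 2 := by
    have h := norm_sub_sq_real x (Real.cos θ • x + Real.sin θ • e)
    rw [norm_cos_smul_add_sin_smul hx he hxe, inner_add_right, real_inner_smul_right,
      real_inner_smul_right, hxe, real_inner_self_eq_norm_sq, hx] at h
    rw [dist_eq_norm, h, mul_pow, Real.sin_sq_eq_half_sub]
    rw [show 2 * (θ / 2) = θ by ring]
    ring
  have h2 : 2 / Real.pi * (θ / 2) ≤ Real.sin (θ / 2) :=
    Real.mul_le_sin (by linarith [hθ.1]) (by linarith [hθ.2])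
  have h0 : 0 ≤ 2 * Real.sin (θ / 2) :=
    mul_nonneg zero_le_two (le_trans (mul_nonneg (by positivity) (by linarith [hθ.1])) h2)
  rw [(pow_left_inj₀ dist_nonneg h0 two_ne_zero).1 h1]
  calc θ = Real.pi * (2 / Real.pi * (θ / 2)) := by field_simp
    _ ≤ Real.pi * Real.sin (θ / 2) := mul_le_mul_of_nonneg_left h2 Real.pi_pos.le
    _ = _ := by ring

/-- The Legendrian Whitney sphere is Lipschitz for the Carnot–Carathéodory metric. -/
lemma ccDist_whitney_le {n : ℕ} (hn : 1 ≤ n) {x y : Euc (n+1)} (hx : ‖x‖ = 1) (hy : ‖y‖ = 1) :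
    ccDist n (whitney n x) (whitney n y) ≤ √(5 * n) * (Real.pi / 2) * dist x y := by
  obtain ⟨e, θ, hθ, he, hxe, rfl⟩ := exists_great_circle hn hx hy
  let σ : ℝ → Euc (n+1) := fun s => Real.cos s • x + Real.sin s • e
  let τ : ℝ → Euc (n+1) := fun s => -Real.sin s • x + Real.cos s • e
  have hσ : ∀ s, HasDerivAt σ (τ s) s := fun s =>
    ((Real.hasDerivAt_cos s).smul_const x).add ((Real.hasDerivAt_sin s).smul_const e)
  have hσn : ∀ s, ‖σ s‖ = 1 := norm_cos_smul_add_sin_smul hx he hxe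
  have hτn : ∀ s, ‖τ s‖ = 1 := by
    intro s
    have := norm_cos_smul_add_sin_smul hx he hxe (s + Real.pi / 2)
    rwa [Real.cos_add_pi_div_two, Real.sin_add_pi_div_two] at this
  have hσc : Continuous σ := by fun_prop
  have hτc : Continuous τ := by fun_prop
  have hg := continuous_whitneyDiff_apply hσc hτc
  have hhor : IsHorizontalWith n 0 θ (fun s => whitney n (σ s))
      (fun s => whitneyDiff n (σ s) (τ s)) := by
    refine ⟨fun i => (hg i).intervalIntegrable _ _, fun i s _ => ?_,
      Filter.Eventually.of_forall fun s => whitneyDiff_contact (hσn s) _⟩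
    rw [intervalIntegral.integral_eq_sub_of_hasDerivAt
      (fun r _ => hasDerivAt_whitney (hσ r) i) ((hg i).intervalIntegrable _ _)]
    ring
  have hd := ccDist_le hθ.1 hhor
  have hlen : horizLength n 0 θ (fun s => whitneyDiff n (σ s) (τ s)) ≤ √(5 * n) * θ := by
    have : ∫ _ in (0:ℝ)..θ, √(5 * n) = √(5 * n) * θ := by
      rw [intervalIntegral.integral_const, sub_zero, smul_eq_mul, mul_comm]
    rw [horizLength, ← this]
    refine intervalIntegral.integral_mono_on hθ.1 (Continuous.intervalIntegrable ?_ _ _)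
      intervalIntegrable_const
      fun s _ => Real.sqrt_le_sqrt (whitneyDiff_horiz_le (hσn s) (hτn s))
    exact Real.continuous_sqrt.comp (continuous_finsetSum _ fun j _ =>
      ((hg _).pow 2).add ((hg _).pow 2))
  have h0 : σ 0 = x := by simp [σ]
  rw [h0] at hd
  rw [mul_assoc]
  exact (hd.trans hlen).trans
    (mul_le_mul_of_nonneg_left (angle_le_mul_dist hx he hxe hθ) (Real.sqrt_nonneg _))

/-- No horizontal map in `W^{1,n+1}` of the ball has the Whitney sphere as its trace. -/
lemma false_of_trace_eq_whitney {n : ℕ} {F : Euc (n+1) → Euc (2*n+1)}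
    {v : Fin (2*n+1) → Fin (n+1) → Euc (n+1) → ℝ}
    (hF : MemW1pHeisWith (n+1) n ((n : ℝ) + 1) (ball (0 : Euc (n+1)) 1) F v)
    (htr : ∀ Fk : ℕ → Euc (n+1) → Euc (2*n+1),
      (∀ j, ∀ i : Fin (2*n+1),
        ContDiffOn ℝ 1 (fun x => Fk j x i) (Metric.closedBall (0 : Euc (n+1)) 1)) →
      (∀ i : Fin (2*n+1),
        Filter.Tendsto (fun j => eLpNorm (fun x => Fk j x i - F x i)
            (ENNReal.ofReal ((n : ℝ) + 1))
            (volume.restrict (Metric.ball (0 : Euc (n+1)) 1)))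
          Filter.atTop (nhds 0)) →
      (∀ i : Fin (2*n+1), ∀ k : Fin (n+1),
        Filter.Tendsto (fun j =>
            eLpNorm (fun x =>
                fderiv ℝ (fun y => Fk j y i) x (EuclideanSpace.single k 1) - v i k x)
              (ENNReal.ofReal ((n : ℝ) + 1))
              (volume.restrict (Metric.ball (0 : Euc (n+1)) 1)))
          Filter.atTop (nhds 0)) →
      ∀ i : Fin (2*n+1),
        Filter.Tendsto (fun j => eLpNorm (fun x => Fk j x i - whitney n x i)
            (ENNReal.ofReal ((n : ℝ) + 1))
            ((μH[(n : ℝ)]).restrict (Metric.sphere (0 : Euc (n+1)) 1)))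
          Filter.atTop (nhds 0)) : False := by
  have hp : ENNReal.ofReal ((n : ℝ) + 1) = ((n + 1 : ℕ) : ENNReal) := by
    rw [← ENNReal.ofReal_natCast]
    push_cast
    rfl
  obtain ⟨hF, hcontact⟩ := hF
  simp only [MemW1pWith, MemLpOn, hp] at hF htr
  have hp1 : (1 : ENNReal) ≤ ((n + 1 : ℕ) : ENNReal) := by
    exact_mod_cast Nat.succ_le_succ n.zero_le
  choose a ha hau hav using fun i => exists_smooth_approx hp1 (ENNReal.natCast_ne_top _)
    (hF i).1 (fun k => ((hF i).2 k).1) (fun k => ((hF i).2 k).2)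
  have hab := htr (fun k x => WithLp.toLp 2 fun i => a i k x)
    (fun k i => ((ha i k).of_le (by simp)).contDiffOn) hau hav
  have hgrad : ∀ i, IsGradientWithTrace n (v i) fun x => whitney n x i := fun i =>
    ⟨fun k => ((hF i).2 k).1, a i, ha i, hav i, hab i⟩
  refine false_of_contact_of_trace hcontact (fun j => ?_) (fun j => ?_) (fun j => ?_) ?_
  · have := IsGradientWithTrace.comp_smooth Real.contDiff_arctan Real.hasDerivAt_arctan
      continuous_inv_one_add_sq abs_inv_one_add_sq_le (hF (xIdx n j)).1
      (fun k => ((hF (xIdx n j)).2 k).1) (ha _) (hau _) (hav _) (hab _)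
    simpa only [whitney, heisVec_xIdx] using this
  · have := IsGradientWithTrace.comp_smooth contDiff_halfLog hasDerivAt_halfLog
      (continuous_id.mul continuous_inv_one_add_sq) abs_mul_inv_one_add_sq_le (hF (xIdx n j)).1
      (fun k => ((hF (xIdx n j)).2 k).1) (ha _) (hau _) (hav _) (hab _)
    simpa only [whitney, heisVec_xIdx] using this
  · simpa only [whitney, heisVec_yIdx] using hgrad (yIdx n j)
  · simpa only [whitney, heisVec_tIdx] using hgrad (tIdx n)

/-- **Proposition (sharpness at `p = n+1`).**
There is a Lipschitz map `f : S^n → ℍⁿ` such that no `F : B^{n+1} → ℍⁿ` satisfies both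
`F ∈ W^{1,n+1}(B^{n+1},ℍⁿ)` and `F|_{S^n} = f` in the sense of traces: whenever
`F_k : B^{n+1} → ℝ^{2n+1}` are `C^1` up to the boundary and `F_k → F` in the
`W^{1,n+1}` norm, the restrictions `F_k|_{S^n}` converge to `f` in `L^{n+1}(S^n)`. -/
theorem no_sobolev_extension_at_critical_exponent (n : ℕ) (hn : 1 ≤ n) :
    ∃ (f : Euc (n+1) → Euc (2*n+1)) (L : ℝ), 0 ≤ L ∧
      (∀ x ∈ Metric.sphere (0 : Euc (n+1)) 1, ∀ y ∈ Metric.sphere (0 : Euc (n+1)) 1,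
        ccDist n (f x) (f y) ≤ L * dist x y) ∧
      ¬ ∃ (F : Euc (n+1) → Euc (2*n+1)) (v : Fin (2*n+1) → Fin (n+1) → Euc (n+1) → ℝ),
          MemW1pHeisWith (n+1) n ((n : ℝ) + 1) (Metric.ball (0 : Euc (n+1)) 1) F v ∧
          ∀ Fk : ℕ → Euc (n+1) → Euc (2*n+1),
            (∀ j, ∀ i : Fin (2*n+1),
              ContDiffOn ℝ 1 (fun x => Fk j x i) (Metric.closedBall (0 : Euc (n+1)) 1)) →
            (∀ i : Fin (2*n+1),
              Filter.Tendsto (fun j => eLpNorm (fun x => Fk j x i - F x i)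
                  (ENNReal.ofReal ((n : ℝ) + 1))
                  (volume.restrict (Metric.ball (0 : Euc (n+1)) 1)))
                Filter.atTop (nhds 0)) →
            (∀ i : Fin (2*n+1), ∀ k : Fin (n+1),
              Filter.Tendsto (fun j =>
                  eLpNorm (fun x =>
                      fderiv ℝ (fun y => Fk j y i) x (EuclideanSpace.single k 1) - v i k x)
                    (ENNReal.ofReal ((n : ℝ) + 1))
                    (volume.restrict (Metric.ball (0 : Euc (n+1)) 1)))
                Filter.atTop (nhds 0)) →
            ∀ i : Fin (2*n+1),
              Filter.Tendsto (fun j => eLpNorm (fun x => Fk j x i - f x i)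
                  (ENNReal.ofReal ((n : ℝ) + 1))
                  ((μH[(n : ℝ)]).restrict (Metric.sphere (0 : Euc (n+1)) 1)))
                Filter.atTop (nhds 0) := by
  refine ⟨whitney n, √(5 * n) * (Real.pi / 2), by positivity, fun x hx y hy =>
    ccDist_whitney_le hn (mem_sphere_zero_iff_norm.1 hx) (mem_sphere_zero_iff_norm.1 hy), ?_⟩
  rintro ⟨F, v, hF, htr⟩
  exact false_of_trace_eq_whitney hF htr

end
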